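/- Let p : ℝ^n → [1,∞) be measurable with p_- > 1 and p_+ < ∞. Then the Hardy–Littlewood maximal operator M is bounded on L^{p(·)} if and only if M is bounded on L^{p'(·)}, where p'(x) := p(x)/(p(x)−1). -/

import Mathlib

open MeasureTheory ENNReal Set

noncomputable section

/-- An axis-parallel cube in `ℝⁿ`, given by its center and (positive) side length. -/
structure RCube (n : ℕ) where
  center : Fin n → ℝ
  side : ℝ
  side_pos : 0 < side

namespace RCube

/-- The (closed) cube as a subset of `ℝⁿ`. -/
def toSet {n : ℕ} (Q : RCube n) : Set (Fin n → ℝ) :=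
  {x | ∀ i, |x i - Q.center i| ≤ Q.side / 2}

/-- `rQ`: the cube concentric with `Q` whose side length is `r` times that of `Q`. -/
def scaledSet {n : ℕ} (Q : RCube n) (r : ℝ) : Set (Fin n → ℝ) :=
  {x | ∀ i, |x i - Q.center i| ≤ r * Q.side / 2}

end RCube

/-- A family of pairwise disjoint cubes. -/
def PairwiseDisjointCubes {n : ℕ} (F : Set (RCube n)) : Prop :=
  F.Pairwise fun Q₁ Q₂ => Disjoint Q₁.toSet Q₂.toSet

/-- The variable Lebesgue norm `‖f‖_{p(·)}` for a real-valued (finite) exponent,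
applied to an `ℝ≥0∞`-valued function: `inf {λ > 0 : ∫ (f/λ)^{p(x)} dx ≤ 1}`. -/
def vnorm {n : ℕ} (p : (Fin n → ℝ) → ℝ) (f : (Fin n → ℝ) → ℝ≥0∞) : ℝ≥0∞ :=
  sInf {lam : ℝ≥0∞ | 0 < lam ∧ (∫⁻ x, (f x / lam) ^ p x) ≤ 1}

/-- `t^e` for `t, e ∈ [0,∞]`, with the standard variable-exponent convention
`t^∞ = 0` for `t ≤ 1` and `t^∞ = ∞` for `t > 1`. -/
def epow (t e : ℝ≥0∞) : ℝ≥0∞ :=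
  if e = ∞ then (if t ≤ 1 then 0 else ∞) else t ^ e.toReal

/-- The variable Lebesgue norm for an exponent with values in `[1,∞]`. -/
def vnormE {n : ℕ} (p : (Fin n → ℝ) → ℝ≥0∞) (f : (Fin n → ℝ) → ℝ≥0∞) : ℝ≥0∞ :=
  sInf {lam : ℝ≥0∞ | 0 < lam ∧ (∫⁻ x, epow (f x / lam) (p x)) ≤ 1}

/-- `|f|` as an `ℝ≥0∞`-valued function. -/
def ofR {n : ℕ} (f : (Fin n → ℝ) → ℝ) : (Fin n → ℝ) → ℝ≥0∞ :=
  fun x => ENNReal.ofReal |f x|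

/-- The `ℝ≥0∞`-valued characteristic function of a set. -/
def chiE {n : ℕ} (S : Set (Fin n → ℝ)) : (Fin n → ℝ) → ℝ≥0∞ :=
  S.indicator fun _ => 1

/-- The Hardy--Littlewood maximal operator (over axis-parallel cubes containing `x`). -/
def hlMaximal {n : ℕ} (f : (Fin n → ℝ) → ℝ) (x : Fin n → ℝ) : ℝ≥0∞ :=
  ⨆ (Q : RCube n) (_ : x ∈ Q.toSet),
    (∫⁻ y in Q.toSet, ENNReal.ofReal |f y|) / volume Q.toSet

/-- `M` is bounded on `L^{p(·)}`: there is `C > 0` with `‖Mf‖_{p(·)} ≤ C ‖f‖_{p(·)}`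
for every `f ∈ L^{p(·)}`. -/
def MaximalBounded {n : ℕ} (p : (Fin n → ℝ) → ℝ) : Prop :=
  ∃ C > (0 : ℝ), ∀ f : (Fin n → ℝ) → ℝ, Measurable f → vnorm p (ofR f) < ∞ →
    vnorm p (hlMaximal f) ≤ ENNReal.ofReal C * vnorm p (ofR f)

/-- The function `∑_{Q ∈ F} t_Q χ_{E_Q}` (for a pairwise disjoint family,
written as a pointwise supremum). -/
def cubeSum {n : ℕ} (F : Set (RCube n)) (t : RCube n → ℝ)
    (E : RCube n → Set (Fin n → ℝ)) (x : Fin n → ℝ) : ℝ≥0∞ :=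
  ⨆ (Q : RCube n) (_ : Q ∈ F) (_ : x ∈ E Q), ENNReal.ofReal (t Q)

/-- `p(·)` satisfies the `A_∞` condition with parameter `lam` and constant `C`. -/
def AInftyWith {n : ℕ} (p : (Fin n → ℝ) → ℝ) (lam C : ℝ) : Prop :=
  ∀ F : Set (RCube n), PairwiseDisjointCubes F →
    ∀ t : RCube n → ℝ, (∀ Q ∈ F, 0 ≤ t Q) →
      ∀ E : RCube n → Set (Fin n → ℝ),
        (∀ Q ∈ F, MeasurableSet (E Q) ∧ E Q ⊆ Q.toSet ∧
          ENNReal.ofReal lam * volume Q.toSet ≤ volume (E Q)) →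
        vnorm p (cubeSum F t RCube.toSet) ≤ ENNReal.ofReal C * vnorm p (cubeSum F t E)

/-- The `A_∞` condition for a real-valued exponent. -/
def AInfty {n : ℕ} (p : (Fin n → ℝ) → ℝ) : Prop :=
  ∃ lam ∈ Ioo (0 : ℝ) 1, ∃ C > (0 : ℝ), AInftyWith p lam C

/-- `p(·)` satisfies the `A_∞` condition with parameter `lam` and constant `C`
(exponent with values in `[1,∞]`). -/
def AInftyWithE {n : ℕ} (p : (Fin n → ℝ) → ℝ≥0∞) (lam C : ℝ) : Prop :=
  ∀ F : Set (RCube n), PairwiseDisjointCubes F →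
    ∀ t : RCube n → ℝ, (∀ Q ∈ F, 0 ≤ t Q) →
      ∀ E : RCube n → Set (Fin n → ℝ),
        (∀ Q ∈ F, MeasurableSet (E Q) ∧ E Q ⊆ Q.toSet ∧
          ENNReal.ofReal lam * volume Q.toSet ≤ volume (E Q)) →
        vnormE p (cubeSum F t RCube.toSet) ≤ ENNReal.ofReal C * vnormE p (cubeSum F t E)

/-- The `A_∞` condition for an exponent with values in `[1,∞]`. -/
def AInftyE {n : ℕ} (p : (Fin n → ℝ) → ℝ≥0∞) : Prop :=
  ∃ lam ∈ Ioo (0 : ℝ) 1, ∃ C > (0 : ℝ), AInftyWithE p lam C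

/-- The nonincreasing-rearrangement value `(f χ_Q)^*(s) = inf {α : |{x ∈ Q : |f x| > α}| ≤ s}`. -/
def rearr {n : ℕ} (f : (Fin n → ℝ) → ℝ) (Q : RCube n) (s : ℝ≥0∞) : ℝ≥0∞ :=
  sInf {a : ℝ≥0∞ | volume {x | x ∈ Q.toSet ∧ a < ENNReal.ofReal |f x|} ≤ s}

/-- The `λ`-median maximal operator `m_λ`. -/
def medianMax {n : ℕ} (lam : ℝ) (f : (Fin n → ℝ) → ℝ) (x : Fin n → ℝ) : ℝ≥0∞ :=
  ⨆ (Q : RCube n) (_ : x ∈ Q.toSet), rearr f Q (ENNReal.ofReal lam * volume Q.toSet)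

/-- The modified median maximal operator `m_{τ,r}` (supremum over cubes `Q` with `x ∈ rQ`). -/
def medianMaxR {n : ℕ} (tau r : ℝ) (f : (Fin n → ℝ) → ℝ) (x : Fin n → ℝ) : ℝ≥0∞ :=
  ⨆ (Q : RCube n) (_ : x ∈ Q.scaledSet r), rearr f Q (ENNReal.ofReal tau * volume Q.toSet)

/-- The average `⟨f⟩_Q = (1/|Q|) ∫_Q f`. -/
def cubeAvg {n : ℕ} (f : (Fin n → ℝ) → ℝ) (Q : RCube n) : ℝ :=
  (∫ y in Q.toSet, f y) / (volume Q.toSet).toReal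

/-- `|T_F f|` for a pairwise disjoint family `F`, written as a pointwise supremum. -/
def avgSum {n : ℕ} (F : Set (RCube n)) (f : (Fin n → ℝ) → ℝ) (x : Fin n → ℝ) : ℝ≥0∞ :=
  ⨆ (Q : RCube n) (_ : Q ∈ F) (_ : x ∈ Q.toSet), ENNReal.ofReal |cubeAvg f Q|

/-- The reverse Hölder condition `RH`. -/
def RHCond {n : ℕ} (p : (Fin n → ℝ) → ℝ) : Prop :=
  ∃ r : ℝ, 1 < r ∧ ∃ C : ℝ, 0 < C ∧
    ∀ S : Set (RCube n), PairwiseDisjointCubes S →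
      ∀ t : RCube n → ℝ, (∀ Q ∈ S, 0 ≤ t Q) →
        (∑' Q : S, ∫⁻ x in Q.1.toSet, ENNReal.ofReal (t Q.1) ^ p x) ≤ 1 →
        (∑' Q : S, volume Q.1.toSet *
            ((∫⁻ x in Q.1.toSet, ENNReal.ofReal (t Q.1) ^ (r * p x)) / volume Q.1.toSet)
              ^ (1 / r)) ≤ ENNReal.ofReal C

/-! ### Basic facts on the variable norm -/

/-- Maximal operator on `ℝ≥0∞`-valued functions. -/
def MM {n : ℕ} (h : (Fin n → ℝ) → ℝ≥0∞) (x : Fin n → ℝ) : ℝ≥0∞ :=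
  ⨆ (Q : RCube n) (_ : x ∈ Q.toSet), (∫⁻ y in Q.toSet, h y) / volume Q.toSet

lemma vnorm_le_of_mod {n : ℕ} {p : (Fin n → ℝ) → ℝ} {f : (Fin n → ℝ) → ℝ≥0∞} {m : ℝ≥0∞}
    (h0 : 0 < m) (h : (∫⁻ x, (f x / m) ^ p x) ≤ 1) : vnorm p f ≤ m :=
  sInf_le ⟨h0, h⟩

lemma mod_le_of_vnorm_lt {n : ℕ} {p : (Fin n → ℝ) → ℝ} {f : (Fin n → ℝ) → ℝ≥0∞} {m : ℝ≥0∞}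
    (hp : ∀ x, 0 ≤ p x) (h : vnorm p f < m) : (∫⁻ x, (f x / m) ^ p x) ≤ 1 := by
  obtain ⟨l, ⟨hl0, hl⟩, hlm⟩ := sInf_lt_iff.1 h
  refine le_trans (lintegral_mono fun x => ?_) hl
  exact ENNReal.rpow_le_rpow (ENNReal.div_le_div_left hlm.le _) (hp x)

lemma vnorm_mono {n : ℕ} {p : (Fin n → ℝ) → ℝ} {f g : (Fin n → ℝ) → ℝ≥0∞}
    (hp : ∀ x, 0 ≤ p x) (h : ∀ x, f x ≤ g x) : vnorm p f ≤ vnorm p g := by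
  refine sInf_le_sInf ?_
  rintro l ⟨h0, hl⟩
  refine ⟨h0, le_trans (lintegral_mono fun x => ?_) hl⟩
  exact ENNReal.rpow_le_rpow (ENNReal.div_le_div_right (h x) _) (hp x)

lemma vnorm_attained {n : ℕ} {p : (Fin n → ℝ) → ℝ} {f : (Fin n → ℝ) → ℝ≥0∞} {B : ℝ}
    (hp : ∀ x, 0 ≤ p x) (hB0 : 0 ≤ B) (hB : ∀ x, p x ≤ B) (h0 : vnorm p f ≠ 0)
    (ht : vnorm p f ≠ ∞) :
    (∫⁻ x, (f x / vnorm p f) ^ p x) ≤ 1 := by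
  set N := vnorm p f with hN
  have key : ∀ e : ℝ≥0∞, 1 < e → e ≠ ∞ → (∫⁻ x, (f x / N) ^ p x) ≤ e ^ B := by
    intro e he het
    have hlt : N < e * N := by
      conv_lhs => rw [← one_mul N]
      exact ENNReal.mul_lt_mul_left h0 ht he
    have h1 := mod_le_of_vnorm_lt (p := p) (f := f) hp hlt
    calc (∫⁻ x, (f x / N) ^ p x) ≤ ∫⁻ x, e ^ B * (f x / (e * N)) ^ p x := by
          refine lintegral_mono fun x => ?_
          have : f x / N = e * (f x / (e * N)) := by
            have he0 : e ≠ 0 := (lt_trans zero_lt_one he).ne'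
            rw [← mul_div_assoc, ENNReal.mul_div_mul_left _ _ he0 het]
          rw [this, ENNReal.mul_rpow_of_nonneg _ _ (hp x)]
          gcongr
          · exact he.le
          · exact hB x
      _ = e ^ B * ∫⁻ x, (f x / (e * N)) ^ p x :=
          lintegral_const_mul' _ _ (ENNReal.rpow_ne_top_of_nonneg hB0 het)
      _ ≤ e ^ B := by
          calc _ ≤ e ^ B * 1 := by gcongr
            _ = _ := mul_one _
  by_contra hcon
  push Not at hcon
  -- choose e with e^B < the integral
  set J := (∫⁻ x, (f x / N) ^ p x) with hJ
  have hc : Filter.Tendsto (fun e : ℝ≥0∞ => e ^ B) (nhdsWithin 1 (Ioi 1)) (nhds (1 ^ B)) :=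
    ((ENNReal.continuous_rpow_const (y := B)).tendsto 1).mono_left nhdsWithin_le_nhds
  rw [ENNReal.one_rpow] at hc
  have h2 : ∀ᶠ e in nhdsWithin (1 : ℝ≥0∞) (Ioi 1), e ^ B < J := hc.eventually (gt_mem_nhds hcon)
  have h3 : ∀ᶠ e in nhdsWithin (1 : ℝ≥0∞) (Ioi 1), e < ∞ :=
    nhdsWithin_le_nhds (gt_mem_nhds ENNReal.one_lt_top)
  have h4 : ∀ᶠ e in nhdsWithin (1 : ℝ≥0∞) (Ioi 1), 1 < e := self_mem_nhdsWithin
  have : (nhdsWithin (1 : ℝ≥0∞) (Ioi 1)).NeBot :=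
    nhdsGT_neBot_of_exists_gt ⟨2, by norm_num⟩
  obtain ⟨e, he1, he2, he3⟩ := (h2.and (h3.and h4)).exists
  exact absurd (key e he3 he2.ne) (not_le.2 he1)

lemma vnorm_const_mul_le {n : ℕ} {p : (Fin n → ℝ) → ℝ} {f : (Fin n → ℝ) → ℝ≥0∞} {c : ℝ≥0∞}
    (hp : ∀ x, 0 ≤ p x) (hc0 : c ≠ 0) (hct : c ≠ ∞) :
    vnorm p (fun x => c * f x) ≤ c * vnorm p f := by
  refine le_of_forall_gt fun m hm => ?_
  obtain ⟨m', h1, h2⟩ := exists_between hm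
  refine lt_of_le_of_lt ?_ h2
  refine vnorm_le_of_mod (pos_of_gt h1) ?_
  have h3 : vnorm p f < m' / c := by
    rw [ENNReal.lt_div_iff_mul_lt (Or.inl hc0) (Or.inl hct), mul_comm]; exact h1
  refine le_trans (le_of_eq ?_) (mod_le_of_vnorm_lt hp h3)
  congr 1
  ext x
  congr 1
  rw [div_eq_mul_inv, div_eq_mul_inv, ENNReal.inv_div (Or.inl hct) (Or.inl hc0), div_eq_mul_inv]
  ring

lemma vnorm_add_le {n : ℕ} {p : (Fin n → ℝ) → ℝ} {f g : (Fin n → ℝ) → ℝ≥0∞}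
    (hpm : Measurable p) (hp : ∀ x, 1 ≤ p x) (hf : Measurable f) :
    vnorm p (fun x => f x + g x) ≤ vnorm p f + vnorm p g := by
  have hp0 : ∀ x, 0 ≤ p x := fun x => zero_le_one.trans (hp x)
  by_cases hft : vnorm p f = ∞
  · simp [hft]
  by_cases hgt : vnorm p g = ∞
  · simp [hgt]
  refine ENNReal.le_of_forall_pos_le_add fun e he _ => ?_
  set a := vnorm p f + (e / 2 : NNReal) with ha
  set b := vnorm p g + (e / 2 : NNReal) with hb
  have he2 : ((e / 2 : NNReal) : ℝ≥0∞) ≠ 0 := by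
    simpa using he.ne'
  have ha1 : vnorm p f < a := ENNReal.lt_add_right hft he2
  have hb1 : vnorm p g < b := ENNReal.lt_add_right hgt he2
  have hab : vnorm p f + vnorm p g + e = a + b := by
    rw [ha, hb]
    have : (e : ℝ≥0∞) = (e / 2 : NNReal) + (e / 2 : NNReal) := by
      rw [← ENNReal.coe_add, add_halves]
    rw [this]; ring
  rw [hab]
  have ha0 : a ≠ 0 := (pos_of_gt ha1).ne'
  have hb0 : b ≠ 0 := (pos_of_gt hb1).ne'
  have hat : a ≠ ∞ := ENNReal.add_ne_top.2 ⟨hft, ENNReal.coe_ne_top⟩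
  have hbt : b ≠ ∞ := ENNReal.add_ne_top.2 ⟨hgt, ENNReal.coe_ne_top⟩
  have hab0 : a + b ≠ 0 := by simp [ha0]
  have habt : a + b ≠ ∞ := ENNReal.add_ne_top.2 ⟨hat, hbt⟩
  refine vnorm_le_of_mod (pos_iff_ne_zero.2 hab0) ?_
  have hw : a / (a + b) + b / (a + b) = 1 := by
    rw [ENNReal.div_add_div_same, ENNReal.div_self hab0 habt]
  calc (∫⁻ x, ((f x + g x) / (a + b)) ^ p x)
      ≤ ∫⁻ x, (a / (a + b) * (f x / a) ^ p x + b / (a + b) * (g x / b) ^ p x) := by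
        refine lintegral_mono fun x => ?_
        refine le_trans (le_of_eq ?_)
          (ENNReal.rpow_arith_mean_le_arith_mean2_rpow _ _ (f x / a) (g x / b) hw (hp x))
        congr 1
        rw [← ENNReal.div_add_div_same]
        congr 1
        · rw [mul_comm, ← mul_div_assoc, ENNReal.div_mul_cancel ha0 hat]
        · rw [mul_comm, ← mul_div_assoc, ENNReal.div_mul_cancel hb0 hbt]
    _ = a / (a + b) * (∫⁻ x, (f x / a) ^ p x) + b / (a + b) * ∫⁻ x, (g x / b) ^ p x := by
        rw [lintegral_add_left, lintegral_const_mul', lintegral_const_mul']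
        · exact ENNReal.div_ne_top hbt hab0
        · exact ENNReal.div_ne_top hat hab0
        · exact ((hf.div_const a).pow hpm).const_mul _
    _ ≤ a / (a + b) * 1 + b / (a + b) * 1 := by
        gcongr
        · exact mod_le_of_vnorm_lt hp0 ha1
        · exact mod_le_of_vnorm_lt hp0 hb1
    _ = 1 := by rw [mul_one, mul_one, hw]

lemma arith_aux {K u v : ℝ≥0∞} (hK0 : K ≠ 0) (hKt : K ≠ ∞) (hut : u ≠ ∞) (hvt : v ≠ ∞)
    (hmod2 : 1 < K * u + v / 2) (huv : u + v ≤ 1) : (4 * K)⁻¹ + (u / 2 + v) ≤ 1 := by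
  lift u to NNReal using hut
  lift v to NNReal using hvt
  lift K to NNReal using hKt
  have e2 : ((2 : ℝ≥0∞)) = ((2 : NNReal) : ℝ≥0∞) := by norm_num
  have e4 : ((4 : ℝ≥0∞)) = ((4 : NNReal) : ℝ≥0∞) := by norm_num
  have hK0' : K ≠ 0 := by simpa using hK0
  rw [e2, ← ENNReal.coe_div (by norm_num)] at hmod2
  rw [e2, e4, ← ENNReal.coe_div (by norm_num), ← ENNReal.coe_mul,
    ← ENNReal.coe_inv (mul_ne_zero (by norm_num) hK0')]
  norm_cast at hmod2 huv ⊢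
  rw [← NNReal.coe_lt_coe] at hmod2
  rw [← NNReal.coe_le_coe] at huv ⊢
  push_cast at hmod2 huv ⊢
  have hKp : (0 : ℝ) < K := NNReal.coe_pos.2 (pos_iff_ne_zero.2 hK0')
  have hv0 : (0 : ℝ) ≤ v := v.2
  have hu0 : (0 : ℝ) ≤ u := u.2
  have hku : 1 / 2 < (K : ℝ) * u := by linarith
  have : (4 * (K : ℝ))⁻¹ ≤ u / 2 := by
    rw [inv_le_iff_one_le_mul₀ (by positivity)]
    linarith
  linarith

/-- The contraction step. -/
lemma contraction_step (B : ℝ) (hB1 : 1 ≤ B) (C : ℝ≥0∞) (hC1 : 1 ≤ C) (hCt : C ≠ ∞) :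
    ∃ θ : ℝ≥0∞, θ ≠ 0 ∧ θ < 1 ∧ ∀ {n : ℕ} (p : (Fin n → ℝ) → ℝ), Measurable p →
      (∀ x, 1 ≤ p x) → (∀ x, p x ≤ B) →
      (∀ h : (Fin n → ℝ) → ℝ≥0∞, Measurable h → (∀ x, h x ≠ ∞) → vnorm p h < ∞ →
        vnorm p (MM h) ≤ C * vnorm p h) →
      ∀ (φ φ' : (Fin n → ℝ) → ℝ≥0∞) (A : Set (Fin n → ℝ)), MeasurableSet A → Measurable φ →
        (∀ x, φ x ≠ ∞) → (∀ x, φ' x ≤ φ x) → (∀ x ∈ A, φ' x ≤ φ x / 2) →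
        (∀ x, φ x ≤ 2 * MM (fun y => A.indicator φ y + φ y / (8 * C)) x) →
        vnorm p φ' ≤ θ * vnorm p φ := by
  have hC0 : C ≠ 0 := (lt_of_lt_of_le zero_lt_one hC1).ne'
  have hB0 : 0 ≤ B := zero_le_one.trans hB1
  set K : ℝ≥0∞ := (8 * C) ^ B with hK
  have h8C1 : 1 ≤ 8 * C := one_le_mul_of_one_le_of_one_le (by norm_num) hC1
  have h8Ct : 8 * C ≠ ∞ := ENNReal.mul_ne_top (by norm_num) hCt
  have h8C0 : 8 * C ≠ 0 := (lt_of_lt_of_le zero_lt_one h8C1).ne'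
  have hKt : K ≠ ∞ := ENNReal.rpow_ne_top_of_nonneg hB0 h8Ct
  have hK1 : 1 ≤ K := ENNReal.one_le_rpow h8C1 (lt_of_lt_of_le zero_lt_one hB1)
  have hK0 : K ≠ 0 := (lt_of_lt_of_le zero_lt_one hK1).ne'
  set T : ℝ≥0∞ := 1 - (4 * K)⁻¹ with hT
  have h4K : (4 * K)⁻¹ ≤ 4⁻¹ := by
    rw [ENNReal.inv_le_inv]
    calc (4 : ℝ≥0∞) = 4 * 1 := (mul_one _).symm
      _ ≤ 4 * K := by gcongr
  have h4K0 : (4 * K)⁻¹ ≠ 0 := ENNReal.inv_ne_zero.2 (ENNReal.mul_ne_top (by norm_num) hKt)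
  have hT1 : T < 1 := ENNReal.sub_lt_self ENNReal.one_ne_top one_ne_zero h4K0
  have hT0 : T ≠ 0 := by
    rw [hT]
    have : (4 * K)⁻¹ < 1 := lt_of_le_of_lt h4K (by
      rw [ENNReal.inv_lt_one]; norm_num)
    exact (tsub_pos_of_lt this).ne'
  have hTt : T ≠ ∞ := (lt_trans hT1 ENNReal.one_lt_top).ne
  have hBp : 0 < B := lt_of_lt_of_le zero_lt_one hB1
  refine ⟨T ^ (1 / B), ?_, ?_, ?_⟩
  · exact (ENNReal.rpow_pos (pos_iff_ne_zero.2 hT0) hTt).ne'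
  · exact ENNReal.rpow_lt_one hT1 (by positivity)
  intro n p hpm hp1 hpB hM φ φ' A hA hφ hφt hle hleA hMM
  have hp0 : ∀ x, 0 ≤ p x := fun x => zero_le_one.trans (hp1 x)
  set θ := T ^ (1 / B) with hθ
  have hθ0 : θ ≠ 0 := (ENNReal.rpow_pos (pos_iff_ne_zero.2 hT0) hTt).ne'
  have hθ1 : θ < 1 := ENNReal.rpow_lt_one hT1 (by positivity)
  have hθt : θ ≠ ∞ := (lt_trans hθ1 ENNReal.one_lt_top).ne
  set N := vnorm p φ with hN
  by_cases hNt : N = ∞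
  · rw [hNt, ENNReal.mul_top hθ0]; exact le_top
  by_cases hN0 : N = 0
  · rw [hN0, mul_zero, ← hN0]; exact vnorm_mono hp0 hle
  set h : (Fin n → ℝ) → ℝ≥0∞ := fun y => A.indicator φ y + φ y / (8 * C) with hh
  have hhm : Measurable h := (hφ.indicator hA).add (hφ.div_const _)
  have hle2 : ∀ x, h x ≤ 2 * φ x := by
    intro x
    rw [hh, two_mul]
    refine add_le_add (Set.indicator_le_self _ _ x) ?_
    exact ENNReal.div_le_of_le_mul (le_mul_of_one_le_right (zero_le) h8C1)
  have hht : ∀ x, h x ≠ ∞ := fun x =>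
    ne_top_of_le_ne_top (ENNReal.mul_ne_top (by norm_num) (hφt x)) (hle2 x)
  have hhn : vnorm p h < ∞ := by
    refine lt_of_le_of_lt (vnorm_mono hp0 hle2) ?_
    refine lt_of_le_of_lt (vnorm_const_mul_le hp0 (by norm_num) (by norm_num)) ?_
    exact ENNReal.mul_lt_top (by norm_num) (lt_top_iff_ne_top.2 hNt)
  have hN2 : N ≤ 2 * C * vnorm p h := by
    calc N ≤ vnorm p (fun x => 2 * MM h x) := vnorm_mono hp0 hMM
      _ ≤ 2 * vnorm p (MM h) := vnorm_const_mul_le hp0 (by norm_num) (by norm_num)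
      _ ≤ 2 * (C * vnorm p h) := by gcongr; exact hM h hhm hht hhn
      _ = _ := by ring
  -- the modular of 4 C h / N exceeds 1
  have h4C0 : 4 * C ≠ 0 := mul_ne_zero (by norm_num) hC0
  have h4Ct : 4 * C ≠ ∞ := ENNReal.mul_ne_top (by norm_num) hCt
  have hmod : 1 < ∫⁻ x, (h x / (N / (4 * C))) ^ p x := by
    by_contra hcon
    push Not at hcon
    have h1 := vnorm_le_of_mod (ENNReal.div_pos hN0 h4Ct) hcon
    have h2 : N ≤ N / 2 := by
      calc N ≤ 2 * C * vnorm p h := hN2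
        _ ≤ 2 * C * (N / (4 * C)) := by gcongr
        _ = N / 2 := by
            rw [← mul_div_assoc]
            have : 4 * C = (2 * C) * 2 := by ring
            rw [this, ENNReal.mul_div_mul_left _ _ (mul_ne_zero (by norm_num) hC0)
              (ENNReal.mul_ne_top (by norm_num) hCt)]
    exact absurd h2 (not_le.2 (ENNReal.half_lt_self hN0 hNt))
  set ψ : (Fin n → ℝ) → ℝ≥0∞ := fun x => (φ x / N) ^ p x with hψ
  have hψm : Measurable ψ := (hφ.div_const N).pow hpm
  set u := ∫⁻ x in A, ψ x with hu
  set v := ∫⁻ x in Aᶜ, ψ x with hv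
  have huv : u + v ≤ 1 := by
    rw [hu, hv, lintegral_add_compl _ hA]
    exact vnorm_attained hp0 hB0 hpB hN0 hNt
  have hhalf : ∀ (z : ℝ≥0∞) (x : Fin n → ℝ), (z / 2) ^ p x ≤ z ^ p x / 2 := by
    intro z x
    rw [ENNReal.div_rpow_of_nonneg _ _ (hp0 x)]
    refine ENNReal.div_le_div_left ?_ _
    calc (2 : ℝ≥0∞) = 2 ^ (1 : ℝ) := (ENNReal.rpow_one _).symm
      _ ≤ 2 ^ p x := ENNReal.rpow_le_rpow_of_exponent_le (by norm_num) (hp1 x)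
  have hmod2 : 1 < K * u + v / 2 := by
    refine lt_of_lt_of_le hmod ?_
    rw [← lintegral_add_compl _ hA, hu, hv, ← lintegral_const_mul' _ _ hKt,
      div_eq_mul_inv (∫⁻ x in Aᶜ, ψ x), ← lintegral_mul_const' _ _ (by simp)]
    refine add_le_add (setLIntegral_mono' hA fun x hx => ?_)
      (setLIntegral_mono' hA.compl fun x hx => ?_)
    · have e1 : h x / (N / (4 * C)) ≤ (8 * C) * (φ x / N) := by
        calc h x / (N / (4 * C)) ≤ (2 * φ x) / (N / (4 * C)) :=
              ENNReal.div_le_div_right (hle2 x) _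
          _ = (8 * C) * (φ x / N) := by
              rw [div_eq_mul_inv, ENNReal.inv_div (Or.inl h4Ct) (Or.inl h4C0), div_eq_mul_inv,
                div_eq_mul_inv]
              ring
      calc (h x / (N / (4 * C))) ^ p x ≤ ((8 * C) * (φ x / N)) ^ p x :=
            ENNReal.rpow_le_rpow e1 (hp0 x)
        _ = (8 * C) ^ p x * (φ x / N) ^ p x := ENNReal.mul_rpow_of_nonneg _ _ (hp0 x)
        _ ≤ K * ψ x := by
            gcongr
            exact ENNReal.rpow_le_rpow_of_exponent_le h8C1 (hpB x)
    · have e0 : h x = φ x / (8 * C) := by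
        rw [hh]; simp [Set.indicator_of_notMem hx]
      have e1 : h x / (N / (4 * C)) = (φ x / N) / 2 := by
        rw [e0, div_eq_mul_inv, ENNReal.inv_div (Or.inl h4Ct) (Or.inl h4C0)]
        have : 8 * C = 2 * (4 * C) := by ring
        rw [this, div_eq_mul_inv, ENNReal.mul_inv (Or.inl (by norm_num)) (Or.inl (by norm_num))]
        calc φ x * (2⁻¹ * (4 * C)⁻¹) * (4 * C / N)
            = φ x * 2⁻¹ * N⁻¹ * ((4 * C)⁻¹ * (4 * C)) := by rw [div_eq_mul_inv]; ring
          _ = φ x / N / 2 := by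
            rw [ENNReal.inv_mul_cancel h4C0 h4Ct, div_eq_mul_inv, div_eq_mul_inv]; ring
      rw [e1, ← div_eq_mul_inv]
      exact hhalf _ x
  have hmod3 : (∫⁻ x, (φ' x / N) ^ p x) ≤ u / 2 + v := by
    rw [← lintegral_add_compl _ hA, hu, hv, div_eq_mul_inv (∫⁻ x in A, ψ x), ← lintegral_mul_const' _ _ (by simp)]
    refine add_le_add (setLIntegral_mono' hA fun x hx => ?_)
      (setLIntegral_mono' hA.compl fun x hx => ?_)
    · calc (φ' x / N) ^ p x ≤ (φ x / N / 2) ^ p x := by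
            refine ENNReal.rpow_le_rpow ?_ (hp0 x)
            refine (ENNReal.div_le_div_right (hleA x hx) _).trans (le_of_eq ?_)
            simp only [div_eq_mul_inv]; ring
        _ ≤ _ := by rw [← div_eq_mul_inv]; exact hhalf _ x
    · exact ENNReal.rpow_le_rpow (ENNReal.div_le_div_right (hle x) _) (hp0 x)
  have hut : u ≠ ∞ := ne_top_of_le_ne_top ENNReal.one_ne_top (le_self_add.trans huv)
  have hvt : v ≠ ∞ := ne_top_of_le_ne_top ENNReal.one_ne_top (le_add_self.trans huv)
  have hfin : u / 2 + v ≤ T := by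
    rw [hT]
    refine ENNReal.le_sub_of_add_le_left (ne_top_of_le_ne_top (by simp) h4K) ?_
    exact arith_aux hK0 hKt hut hvt hmod2 huv
  have hθN0 : θ * N ≠ 0 := mul_ne_zero hθ0 hN0
  refine vnorm_le_of_mod (pos_iff_ne_zero.2 hθN0) ?_
  have hTi : θ⁻¹ ^ B = T⁻¹ := by
    rw [ENNReal.inv_rpow, hθ, ← ENNReal.rpow_mul, one_div, inv_mul_cancel₀ hBp.ne',
      ENNReal.rpow_one]
  calc (∫⁻ x, (φ' x / (θ * N)) ^ p x) ≤ ∫⁻ x, T⁻¹ * (φ' x / N) ^ p x := by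
        refine lintegral_mono fun x => ?_
        have : φ' x / (θ * N) = θ⁻¹ * (φ' x / N) := by
          rw [div_eq_mul_inv, ENNReal.mul_inv (Or.inl hθ0) (Or.inl hθt), div_eq_mul_inv]; ring
        rw [this, ENNReal.mul_rpow_of_nonneg _ _ (hp0 x), ← hTi]
        gcongr
        · exact ENNReal.one_le_inv.2 hθ1.le
        · exact hpB x
    _ = T⁻¹ * ∫⁻ x, (φ' x / N) ^ p x := lintegral_const_mul' _ _ (ENNReal.inv_ne_top.2 hT0)
    _ ≤ T⁻¹ * T := by gcongr; exact hmod3.trans hfin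
    _ = 1 := ENNReal.inv_mul_cancel hT0 hTt


/-! ### Dyadic cubes -/

/-- Dyadic cube with index `(k, m)`: side `2^k`, lower corner `2^k m`. -/
def Dy {n : ℕ} (i : ℤ × (Fin n → ℤ)) : Set (Fin n → ℝ) :=
  univ.pi fun t => Ico ((i.2 t : ℝ) * 2 ^ i.1) (((i.2 t : ℝ) + 1) * 2 ^ i.1)

/-- The closed cube with the same closure as `Dy i`. -/
def Cub {n : ℕ} (i : ℤ × (Fin n → ℤ)) : RCube n :=
  ⟨fun t => ((i.2 t : ℝ) + 1 / 2) * 2 ^ i.1, 2 ^ i.1, by positivity⟩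

/-- The closed concentric cube of triple side. -/
def Tri {n : ℕ} (i : ℤ × (Fin n → ℤ)) : RCube n :=
  ⟨fun t => ((i.2 t : ℝ) + 1 / 2) * 2 ^ i.1, 3 * 2 ^ i.1, by positivity⟩

lemma toSet_eq {n : ℕ} (Q : RCube n) :
    Q.toSet = Icc (fun t => Q.center t - Q.side / 2) (fun t => Q.center t + Q.side / 2) := by
  ext x
  simp only [RCube.toSet, mem_ofPred_eq, mem_Icc, Pi.le_def, abs_le]
  constructor
  · intro h
    exact ⟨fun i => by linarith [(h i).1], fun i => by linarith [(h i).2]⟩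
  · rintro ⟨h1, h2⟩ i
    exact ⟨by linarith [h1 i], by linarith [h2 i]⟩

lemma volume_toSet {n : ℕ} (Q : RCube n) : volume Q.toSet = ENNReal.ofReal Q.side ^ n := by
  rw [toSet_eq, Real.volume_Icc_pi]
  have : ∀ t : Fin n, Q.center t + Q.side / 2 - (Q.center t - Q.side / 2) = Q.side := by
    intro t; ring
  simp [this]

lemma measurableSet_toSet {n : ℕ} (Q : RCube n) : MeasurableSet Q.toSet := by
  rw [toSet_eq]; exact measurableSet_Icc

lemma volume_Dy {n : ℕ} (i : ℤ × (Fin n → ℤ)) :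
    volume (Dy i) = ENNReal.ofReal (2 ^ i.1) ^ n := by
  rw [Dy, Real.volume_pi_Ico]
  have : ∀ t : Fin n, ((i.2 t : ℝ) + 1) * 2 ^ i.1 - (i.2 t : ℝ) * 2 ^ i.1 = 2 ^ i.1 := by
    intro t; ring
  simp [this]

lemma measurableSet_Dy {n : ℕ} (i : ℤ × (Fin n → ℤ)) : MeasurableSet (Dy i) :=
  MeasurableSet.univ_pi fun _ => measurableSet_Ico

lemma volume_Dy_ne_zero {n : ℕ} (i : ℤ × (Fin n → ℤ)) : volume (Dy i) ≠ 0 := by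
  rw [volume_Dy]
  refine pow_ne_zero _ ?_
  have : (0 : ℝ) < 2 ^ i.1 := by positivity
  simpa using this

lemma volume_Dy_ne_top {n : ℕ} (i : ℤ × (Fin n → ℤ)) : volume (Dy i) ≠ ∞ := by
  rw [volume_Dy]
  exact ENNReal.pow_ne_top ENNReal.ofReal_ne_top

lemma volume_Cub {n : ℕ} (i : ℤ × (Fin n → ℤ)) : volume (Cub i).toSet = volume (Dy i) := by
  rw [volume_toSet, volume_Dy]; rfl

lemma volume_Tri {n : ℕ} (i : ℤ × (Fin n → ℤ)) :
    volume (Tri i).toSet = 3 ^ n * volume (Dy i) := by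
  rw [volume_toSet, volume_Dy, ← mul_pow]
  congr 1
  change ENNReal.ofReal (3 * 2 ^ i.1) = _
  rw [ENNReal.ofReal_mul (by norm_num)]
  norm_num

lemma Dy_subset_Cub {n : ℕ} (i : ℤ × (Fin n → ℤ)) : Dy i ⊆ (Cub i).toSet := by
  intro x hx t
  have h := hx t (mem_univ t)
  simp only [Cub]
  rw [abs_le]
  constructor <;> nlinarith [h.1, h.2]

lemma Dy_subset_Tri {n : ℕ} (i : ℤ × (Fin n → ℤ)) : Dy i ⊆ (Tri i).toSet := by
  intro x hx t
  have h := hx t (mem_univ t)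
  have : (0 : ℝ) < 2 ^ i.1 := by positivity
  simp only [Tri]
  rw [abs_le]
  constructor <;> nlinarith [h.1, h.2]

lemma dyadic_coord {k k' m m' : ℤ} (hk : k ≤ k') {x : ℝ}
    (h : x ∈ Ico ((m : ℝ) * 2 ^ k) (((m : ℝ) + 1) * 2 ^ k))
    (h' : x ∈ Ico ((m' : ℝ) * 2 ^ k') (((m' : ℝ) + 1) * 2 ^ k')) :
    (m' : ℝ) * 2 ^ k' ≤ m * 2 ^ k ∧ ((m : ℝ) + 1) * 2 ^ k ≤ (m' + 1) * 2 ^ k' := by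
  obtain ⟨d, rfl⟩ := Int.le.dest hk
  have hp : (0 : ℝ) < 2 ^ k := by positivity
  have e : (2 : ℝ) ^ (k + (d : ℤ)) = 2 ^ d * 2 ^ k := by
    rw [zpow_add₀ (by norm_num), zpow_natCast, mul_comm]
  rw [e, ← mul_assoc, ← mul_assoc] at h' ⊢
  have h1 : (m' : ℝ) * 2 ^ d < m + 1 := lt_of_mul_lt_mul_right (h'.1.trans_lt h.2) hp.le
  have h2 : (m : ℝ) < (m' + 1) * 2 ^ d := lt_of_mul_lt_mul_right (h.1.trans_lt h'.2) hp.le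
  have h1' : m' * 2 ^ d < m + 1 := by exact_mod_cast h1
  have h2' : m < (m' + 1) * 2 ^ d := by exact_mod_cast h2
  have h1'' : m' * 2 ^ d ≤ m := by omega
  have h2'' : m + 1 ≤ (m' + 1) * 2 ^ d := by omega
  constructor
  · refine mul_le_mul_of_nonneg_right ?_ hp.le
    exact_mod_cast h1''
  · refine mul_le_mul_of_nonneg_right ?_ hp.le
    exact_mod_cast h2''

lemma Dy_nested {n : ℕ} {i j : ℤ × (Fin n → ℤ)} (hk : i.1 ≤ j.1) {x : Fin n → ℝ}
    (hi : x ∈ Dy i) (hj : x ∈ Dy j) : Dy i ⊆ Dy j := by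
  intro y hy t _
  have h := dyadic_coord hk (hi t (mem_univ t)) (hj t (mem_univ t))
  have h2 := hy t (mem_univ t)
  exact ⟨h.1.trans h2.1, h2.2.trans_le h.2⟩

lemma Tri_nested {n : ℕ} {i j : ℤ × (Fin n → ℤ)} (hk : i.1 ≤ j.1) {x : Fin n → ℝ}
    (hi : x ∈ Dy i) (hj : x ∈ Dy j) : (Tri i).toSet ⊆ (Tri j).toSet := by
  intro y hy t
  have h := dyadic_coord hk (hi t (mem_univ t)) (hj t (mem_univ t))
  have h2 := hy t
  have h3 : (2 : ℝ) ^ i.1 ≤ 2 ^ j.1 := zpow_le_zpow_right₀ (by norm_num) hk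
  simp only [Tri] at h2 ⊢
  rw [abs_le] at h2 ⊢
  constructor <;> nlinarith [h.1, h.2, h2.1, h2.2]

lemma Dy_eq_of_rank {n : ℕ} {i j : ℤ × (Fin n → ℤ)} (hk : i.1 = j.1) {x : Fin n → ℝ}
    (hi : x ∈ Dy i) (hj : x ∈ Dy j) : i = j := by
  refine Prod.ext hk (funext fun t => ?_)
  have h := dyadic_coord hk.le (hi t (mem_univ t)) (hj t (mem_univ t))
  have h' := dyadic_coord hk.ge (hj t (mem_univ t)) (hi t (mem_univ t))
  have hp : (0 : ℝ) < 2 ^ j.1 := by positivity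
  have e := le_antisymm h.1 h'.1
  rw [hk] at e
  have := mul_right_cancel₀ hp.ne' e
  exact_mod_cast this.symm

lemma avg_le_MM {n : ℕ} (h : (Fin n → ℝ) → ℝ≥0∞) (i : ℤ × (Fin n → ℤ)) {x : Fin n → ℝ}
    (hx : x ∈ Dy i) : (∫⁻ y in Dy i, h y) / volume (Dy i) ≤ MM h x := by
  refine le_trans ?_ (le_iSup₂_of_le (Cub i) (Dy_subset_Cub i hx) le_rfl)
  rw [volume_Cub]
  exact ENNReal.div_le_div_right (lintegral_mono_set (Dy_subset_Cub i)) _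

/-! ### Sparse sums versus sparse suprema -/

/-- `sup_{i ∈ S} a_i χ_{Dy i}`. -/
def phi {n : ℕ} (S : Finset (ℤ × (Fin n → ℤ))) (a : ℤ × (Fin n → ℤ) → ℝ≥0∞)
    (x : Fin n → ℝ) : ℝ≥0∞ :=
  S.sup fun i => (Dy i).indicator (fun _ => a i) x

/-- `∑_{i ∈ S} a_i χ_{Dy i}`. -/
def sig {n : ℕ} (S : Finset (ℤ × (Fin n → ℤ))) (a : ℤ × (Fin n → ℤ) → ℝ≥0∞)
    (x : Fin n → ℝ) : ℝ≥0∞ :=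
  ∑ i ∈ S, (Dy i).indicator (fun _ => a i) x

/-- The part of `Dy i` not covered by smaller cubes of the family. -/
def ES {n : ℕ} (S : Finset (ℤ × (Fin n → ℤ))) (i : ℤ × (Fin n → ℤ)) : Set (Fin n → ℝ) :=
  Dy i \ ⋃ j ∈ S.filter (fun j => j.1 < i.1), Dy j

/-- Sparseness. -/
def Sparse {n : ℕ} (S : Finset (ℤ × (Fin n → ℤ))) : Prop :=
  ∀ i ∈ S, volume (Dy i) ≤ 2 * volume (ES S i)

lemma Sparse.subset {n : ℕ} {S T : Finset (ℤ × (Fin n → ℤ))} (hS : Sparse S) (h : T ⊆ S) :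
    Sparse T := by
  intro i hi
  refine (hS i (h hi)).trans ?_
  gcongr
  refine sdiff_subset_sdiff_right ?_
  refine biUnion_subset_biUnion_left ?_
  intro j hj
  have hj' : j ∈ T.filter (fun j => j.1 < i.1) := hj
  have := Finset.filter_subset_filter (fun j : ℤ × (Fin n → ℤ) => j.1 < i.1) h hj'
  exact this

lemma measurable_phi {n : ℕ} (S : Finset (ℤ × (Fin n → ℤ))) (a : ℤ × (Fin n → ℤ) → ℝ≥0∞) :
    Measurable (phi S a) := by
  have : phi S a = fun x => ⨆ i ∈ (S : Set (ℤ × (Fin n → ℤ))),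
      (Dy i).indicator (fun _ => a i) x := by
    ext x; rw [phi, Finset.sup_eq_iSup]; rfl
  rw [this]
  exact Measurable.biSup _ S.countable_toSet fun i _ =>
    measurable_const.indicator (measurableSet_Dy i)

lemma measurable_sig {n : ℕ} (S : Finset (ℤ × (Fin n → ℤ))) (a : ℤ × (Fin n → ℤ) → ℝ≥0∞) :
    Measurable (sig S a) :=
  Finset.measurable_fun_sum S fun i _ => measurable_const.indicator (measurableSet_Dy i)

lemma le_phi {n : ℕ} {S : Finset (ℤ × (Fin n → ℤ))} {a : ℤ × (Fin n → ℤ) → ℝ≥0∞}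
    {i : ℤ × (Fin n → ℤ)} (hi : i ∈ S) {x : Fin n → ℝ} (hx : x ∈ Dy i) : a i ≤ phi S a x := by
  have := Finset.le_sup (f := fun i => (Dy i).indicator (fun _ => a i) x) hi
  simpa [hx, phi] using this

lemma phi_attained {n : ℕ} {S : Finset (ℤ × (Fin n → ℤ))} {a : ℤ × (Fin n → ℤ) → ℝ≥0∞}
    {x : Fin n → ℝ} (h : phi S a x ≠ 0) : ∃ i ∈ S, x ∈ Dy i ∧ a i = phi S a x := by
  have hne : S.Nonempty := by
    by_contra hc
    rw [Finset.not_nonempty_iff_eq_empty] at hc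
    subst hc
    exact h (by simp [phi])
  obtain ⟨i, hi, he⟩ := Finset.exists_mem_eq_sup S hne
    (fun i => (Dy i).indicator (fun _ => a i) x)
  have hx : x ∈ Dy i := by
    by_contra hx
    apply h
    rw [phi, he, indicator_of_notMem hx]
  refine ⟨i, hi, hx, ?_⟩
  rw [phi, he, indicator_of_mem hx]

lemma phi_le {n : ℕ} {S : Finset (ℤ × (Fin n → ℤ))} {a : ℤ × (Fin n → ℤ) → ℝ≥0∞}
    {x : Fin n → ℝ} {c : ℝ≥0∞} (h : ∀ i ∈ S, x ∈ Dy i → a i ≤ c) : phi S a x ≤ c := by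
  refine Finset.sup_le fun i hi => ?_
  by_cases hx : x ∈ Dy i
  · simpa [hx] using h i hi hx
  · simp [hx]

lemma sep_sum_le {ι : Type*} (T : Finset ι) (a : ι → ℝ≥0∞)
    (hinj : ∀ i ∈ T, ∀ j ∈ T, i ≠ j → a i ≠ a j)
    (hsep : ∀ i ∈ T, ∀ j ∈ T, a i < a j → 2 * a i ≤ a j) :
    ∑ i ∈ T, a i ≤ 2 * T.sup a := by
  classical
  induction T using Finset.induction_on_max_value a with
  | empty => simp
  | insert m s hm hmax ih =>
    rw [Finset.sum_insert hm, two_mul]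
    have hsup : a m ≤ (insert m s).sup a := Finset.le_sup (Finset.mem_insert_self _ _)
    refine add_le_add hsup ?_
    refine le_trans (ih ?_ ?_) (le_trans ?_ hsup)
    · exact fun i hi j hj => hinj i (Finset.mem_insert_of_mem hi) j (Finset.mem_insert_of_mem hj)
    · exact fun i hi j hj => hsep i (Finset.mem_insert_of_mem hi) j (Finset.mem_insert_of_mem hj)
    have : s.sup a ≤ a m / 2 := by
      refine Finset.sup_le fun i hi => ?_
      rw [ENNReal.le_div_iff_mul_le (by simp) (by simp), mul_comm]
      refine hsep i (Finset.mem_insert_of_mem hi) m (Finset.mem_insert_self _ _) ?_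
      refine lt_of_le_of_ne (hmax i hi) ?_
      refine hinj i (Finset.mem_insert_of_mem hi) m (Finset.mem_insert_self _ _) ?_
      rintro rfl; exact hm hi
    calc 2 * s.sup a ≤ 2 * (a m / 2) := by gcongr
      _ = a m := ENNReal.mul_div_cancel (by norm_num) (by norm_num)

/-- Key inequality for separated coefficients. -/
lemma sparse_sum_sep {n : ℕ} {p : (Fin n → ℝ) → ℝ} (hpm : Measurable p) (hp1 : ∀ x, 1 ≤ p x)
    {C θ : ℝ≥0∞} (hC1 : 1 ≤ C) (hCt : C ≠ ∞) (hθ1 : θ < 1)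
    (hstep : ∀ (φ φ' : (Fin n → ℝ) → ℝ≥0∞) (A : Set (Fin n → ℝ)), MeasurableSet A →
        Measurable φ →
        (∀ x, φ x ≠ ∞) → (∀ x, φ' x ≤ φ x) → (∀ x ∈ A, φ' x ≤ φ x / 2) →
        (∀ x, φ x ≤ 2 * MM (fun y => A.indicator φ y + φ y / (8 * C)) x) →
        vnorm p φ' ≤ θ * vnorm p φ)
    (a : ℤ × (Fin n → ℤ) → ℝ≥0∞) (hat : ∀ i, a i ≠ ∞)
    (hsep : ∀ i j, a i < a j → (8 * C) * a i ≤ a j)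
    (S : Finset (ℤ × (Fin n → ℤ))) (hS : Sparse S) :
    vnorm p (sig S a) ≤ 2 / (1 - θ) * vnorm p (phi S a) := by
  classical
  have hp0 : ∀ x, 0 ≤ p x := fun x => zero_le_one.trans (hp1 x)
  have h8C1 : 2 ≤ 8 * C := by
    calc (2 : ℝ≥0∞) ≤ 8 * 1 := by norm_num
      _ ≤ 8 * C := by gcongr
  have h8Ct : 8 * C ≠ ∞ := ENNReal.mul_ne_top (by norm_num) hCt
  have h8C0 : 8 * C ≠ 0 := (lt_of_lt_of_le (by norm_num) h8C1).ne'
  induction S using Finset.strongInduction with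
  | H S ih =>
  by_cases hne : S = ∅
  · subst hne
    have : sig (∅ : Finset (ℤ × (Fin n → ℤ))) a = fun _ => 0 := by ext x; simp [sig]
    have h0 : vnorm p (sig (∅ : Finset (ℤ × (Fin n → ℤ))) a) = 0 := by
      rw [this]
      refine le_antisymm (le_of_forall_gt fun m hm => ?_) zero_le
      obtain ⟨m', h1, h2⟩ := exists_between hm
      refine lt_of_le_of_lt (vnorm_le_of_mod h1 ?_) h2
      have : ∀ x, (0 / m') ^ p x = 0 := fun x => by
        rw [ENNReal.zero_div, ENNReal.zero_rpow_of_pos (lt_of_lt_of_le zero_lt_one (hp1 x))]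
      simp only [this]
      simp
    rw [h0]; exact zero_le
  set P : ℤ × (Fin n → ℤ) → Prop :=
    fun i => ∀ j ∈ S, a j = a i → i.1 < j.1 → Disjoint (Dy i) (Dy j) with hP
  set S₀ := S.filter P with hS₀
  set S' := S.filter (fun i => ¬ P i) with hS'
  have hsub : S' ⊆ S := Finset.filter_subset _ _
  have hss : S' ⊂ S := by
    refine Finset.filter_ssubset.2 ?_
    obtain ⟨i, hi, hmax⟩ := Finset.exists_max_image S (fun i => i.1)
      (Finset.nonempty_iff_ne_empty.2 hne)
    refine ⟨i, hi, not_not.2 ?_⟩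
    intro j hj _ hlt
    exact absurd (hmax j hj) (not_le.2 hlt)
  -- sum over S₀
  have hsum0 : ∀ x, sig S₀ a x ≤ 2 * phi S a x := by
    intro x
    have e : sig S₀ a x = ∑ i ∈ S₀.filter (fun i => x ∈ Dy i), a i := by
      rw [sig, Finset.sum_filter (fun i => x ∈ Dy i)]
      refine Finset.sum_congr rfl fun i _ => ?_
      simp [indicator]
    rw [e]
    refine le_trans (sep_sum_le _ a ?_ ?_) ?_
    · intro i hi j hj hij hne
      simp only [Finset.mem_filter, hS₀] at hi hj
      rcases lt_trichotomy i.1 j.1 with h | h | h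
      · exact Set.disjoint_left.1 (hi.1.2 j hj.1.1 hne.symm h) hi.2 hj.2
      · exact hij (Dy_eq_of_rank h hi.2 hj.2)
      · exact Set.disjoint_left.1 (hj.1.2 i hi.1.1 hne h) hj.2 hi.2
    · intro i _ j _ h
      refine le_trans ?_ (hsep i j h)
      gcongr
    · gcongr
      refine Finset.sup_le fun i hi => ?_
      simp only [Finset.mem_filter, hS₀] at hi
      exact le_phi hi.1.1 hi.2
  have hphi' : ∀ x, phi S' a x ≤ phi S a x := fun x =>
    phi_le fun i hi hx => le_phi (hsub hi) hx
  have hphit : ∀ x, phi S a x ≠ ∞ := by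
    intro x h
    obtain ⟨i, _, _, he⟩ := phi_attained (S := S) (a := a) (x := x) (by rw [h]; simp)
    exact hat i (he.trans h)
  set A : Set (Fin n → ℝ) := {x | phi S' a x ≤ phi S a x / (8 * C)} with hA
  have hAm : MeasurableSet A :=
    measurableSet_le (measurable_phi _ _) ((measurable_phi _ _).div_const _)
  have hcontr : vnorm p (phi S' a) ≤ θ * vnorm p (phi S a) := by
    refine hstep (phi S a) (phi S' a) A hAm (measurable_phi _ _) hphit hphi' ?_ ?_
    · intro x hx
      exact le_trans hx (ENNReal.div_le_div_left h8C1 _)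
    intro x
    by_cases hx0 : phi S a x = 0
    · rw [hx0]; exact zero_le
    set h : (Fin n → ℝ) → ℝ≥0∞ := fun y => A.indicator (phi S a) y + phi S a y / (8 * C) with hh
    obtain ⟨i0, hi0, hxi0, hei0⟩ := phi_attained hx0
    obtain ⟨i, hi, hmax⟩ := Finset.exists_max_image
      (S.filter fun i => x ∈ Dy i ∧ a i = phi S a x) (fun i => i.1)
      ⟨i0, Finset.mem_filter.2 ⟨hi0, hxi0, hei0⟩⟩
    simp only [Finset.mem_filter] at hi hmax
    obtain ⟨hiS, hxi, hai⟩ := hi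
    have hiP : P i := by
      intro j hj haj hlt
      rw [Set.disjoint_left]
      intro y hyi hyj
      have hsubij := Dy_nested hlt.le hyi hyj
      exact absurd (hmax j ⟨hj, hsubij hxi, haj.trans hai⟩) (not_le.2 hlt)
    have hE : ∀ y ∈ ES S i, a i ≤ h y := by
      intro y hy
      have hyi : y ∈ Dy i := hy.1
      have h1 : a i ≤ phi S a y := le_phi hiS hyi
      rcases h1.lt_or_eq with h2 | h2
      · have hy0 : phi S a y ≠ 0 := (pos_of_gt h2).ne'
        obtain ⟨j, hj, hyj, haj⟩ := phi_attained hy0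
        have h3 := hsep i j (by rw [haj]; exact h2)
        rw [haj] at h3
        refine le_trans ?_ (le_add_self)
        rw [ENNReal.le_div_iff_mul_le (Or.inl h8C0) (Or.inl h8Ct), mul_comm]
        exact h3
      · have hyA : y ∈ A := by
          change phi S' a y ≤ _
          refine phi_le fun j hj hyj => ?_
          have hj' := hj
          simp only [hS', Finset.mem_filter] at hj'
          have h4 : a j ≤ a i := by rw [h2]; exact le_phi hj'.1 hyj
          rcases h4.lt_or_eq with h5 | h5
          · rw [ENNReal.le_div_iff_mul_le (Or.inl h8C0) (Or.inl h8Ct), mul_comm, ← h2]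
            exact hsep j i h5
          · exfalso
            rcases lt_trichotomy i.1 j.1 with h | h | h
            · exact Set.disjoint_left.1 (hiP j hj'.1 h5 h) hyi hyj
            · have := Dy_eq_of_rank h hyi hyj
              subst this
              exact hj'.2 hiP
            · refine hy.2 ?_
              exact mem_biUnion (show j ∈ _ from Finset.mem_filter.2 ⟨hj'.1, h⟩) hyj
        rw [h2, hh]
        simp [hyA]
    have hESm : MeasurableSet (ES S i) :=
      (measurableSet_Dy i).diff (Finset.measurableSet_biUnion _ fun j _ => measurableSet_Dy j)
    have h6 : a i * volume (Dy i) ≤ 2 * ∫⁻ y in Dy i, h y := by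
      calc a i * volume (Dy i) ≤ a i * (2 * volume (ES S i)) := by gcongr; exact hS i hiS
        _ = 2 * (a i * volume (ES S i)) := by ring
        _ = 2 * ∫⁻ y in ES S i, a i := by rw [setLIntegral_const]
        _ ≤ 2 * ∫⁻ y in ES S i, h y := by gcongr 2 * ?_; exact setLIntegral_mono' hESm hE
        _ ≤ 2 * ∫⁻ y in Dy i, h y := by
          gcongr 2 * ?_; exact lintegral_mono_set sdiff_subset
    calc phi S a x = a i := hai.symm
      _ ≤ (2 * ∫⁻ y in Dy i, h y) / volume (Dy i) := by
        rwa [ENNReal.le_div_iff_mul_le (Or.inl (volume_Dy_ne_zero i)) (Or.inl (volume_Dy_ne_top i))]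
      _ = 2 * ((∫⁻ y in Dy i, h y) / volume (Dy i)) := mul_div_assoc _ _ _
      _ ≤ 2 * MM h x := by gcongr; exact avg_le_MM h i hxi
  have h1θ0 : 1 - θ ≠ 0 := (tsub_pos_of_lt hθ1).ne'
  have h1θt : 1 - θ ≠ ∞ := ENNReal.sub_ne_top ENNReal.one_ne_top
  have hsplit : sig S a = fun x => sig S₀ a x + sig S' a x := by
    ext x
    rw [sig, sig, sig, hS₀, hS', Finset.sum_filter_add_sum_filter_not]
  calc vnorm p (sig S a) ≤ vnorm p (sig S₀ a) + vnorm p (sig S' a) := by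
        rw [hsplit]; exact vnorm_add_le hpm hp1 (measurable_sig _ _)
    _ ≤ 2 * vnorm p (phi S a) + 2 / (1 - θ) * (θ * vnorm p (phi S a)) := by
        refine add_le_add ?_ ?_
        · exact (vnorm_mono hp0 hsum0).trans (vnorm_const_mul_le hp0 (by norm_num) (by norm_num))
        · refine (ih S' hss (hS.subset hsub)).trans ?_
          gcongr
    _ = 2 / (1 - θ) * ((1 - θ) + θ) * vnorm p (phi S a) := by
        rw [mul_add, ENNReal.div_mul_cancel h1θ0 h1θt]; ring
    _ = 2 / (1 - θ) * vnorm p (phi S a) := by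
        rw [tsub_add_cancel_of_le hθ1.le, mul_one]

/-- Key inequality for general coefficients. -/
lemma sparse_sum {n : ℕ} {p : (Fin n → ℝ) → ℝ} (hpm : Measurable p) (hp1 : ∀ x, 1 ≤ p x)
    {B : ℝ} (hpB : ∀ x, p x ≤ B) {C : ℝ≥0∞} (hC1 : 1 ≤ C) (hCt : C ≠ ∞)
    (hM : ∀ h : (Fin n → ℝ) → ℝ≥0∞, Measurable h → (∀ x, h x ≠ ∞) → vnorm p h < ∞ →
        vnorm p (MM h) ≤ C * vnorm p h) :
    ∃ D : ℝ≥0∞, D ≠ ∞ ∧ ∀ (S : Finset (ℤ × (Fin n → ℤ))), Sparse S →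
      ∀ a : ℤ × (Fin n → ℤ) → ℝ≥0∞, (∀ i, a i ≠ ∞) →
        vnorm p (sig S a) ≤ D * vnorm p (phi S a) := by
  classical
  have hp0 : ∀ x, 0 ≤ p x := fun x => zero_le_one.trans (hp1 x)
  have hB1 : 1 ≤ B := (hp1 0).trans (hpB 0)
  obtain ⟨θ, hθ0, hθ1, hstep⟩ := contraction_step B hB1 C hC1 hCt
  have hst := hstep p hpm hp1 hpB hM
  have h1θ0 : 1 - θ ≠ 0 := (tsub_pos_of_lt hθ1).ne'
  have h8C1 : 1 < 8 * C := by
    calc (1 : ℝ≥0∞) < 8 * 1 := by norm_num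
      _ ≤ 8 * C := by gcongr
  have h8Ct : 8 * C ≠ ∞ := ENNReal.mul_ne_top (by norm_num) hCt
  have h8C0 : 8 * C ≠ 0 := (lt_of_lt_of_le (by norm_num) h8C1.le).ne'
  refine ⟨8 * C * (2 / (1 - θ)), ENNReal.mul_ne_top h8Ct (ENNReal.div_ne_top (by norm_num) h1θ0),
    ?_⟩
  intro S hS a hat
  have hex : ∀ i, ∃ z : ℤ, a i ≠ 0 → a i ∈ Ico ((8 * C) ^ z) ((8 * C) ^ (z + 1)) := by
    intro i
    by_cases h : a i = 0
    · exact ⟨0, fun h' => absurd h h'⟩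
    · obtain ⟨z, hz⟩ := ENNReal.exists_mem_Ico_zpow h (hat i) h8C1 h8Ct
      exact ⟨z, fun _ => hz⟩
  choose z hz using hex
  set a' : ℤ × (Fin n → ℤ) → ℝ≥0∞ := fun i => if a i = 0 then 0 else (8 * C) ^ z i with ha'
  have hle : ∀ i, a' i ≤ a i := by
    intro i
    by_cases h : a i = 0
    · simp [ha', h]
    · simp only [ha', h, if_false]; exact (hz i h).1
  have hge : ∀ i, a i ≤ (8 * C) * a' i := by
    intro i
    by_cases h : a i = 0
    · simp [h]
    · simp only [ha', h, if_false]
      refine (hz i h).2.le.trans (le_of_eq ?_)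
      rw [ENNReal.zpow_add h8C0 h8Ct, zpow_one, mul_comm]
  have hat' : ∀ i, a' i ≠ ∞ := fun i => ne_top_of_le_ne_top (hat i) (hle i)
  have hsep : ∀ i j, a' i < a' j → (8 * C) * a' i ≤ a' j := by
    intro i j hij
    by_cases h : a i = 0
    · simp [ha', h]
    by_cases h2 : a j = 0
    · simp [ha', h2] at hij
    simp only [ha', h, h2, if_false] at hij ⊢
    have hlt : z i < z j := by
      by_contra hc
      exact absurd (ENNReal.zpow_le_of_le h8C1.le (not_lt.1 hc)) (not_le.2 hij)
    calc (8 * C) * (8 * C) ^ z i = (8 * C) ^ (z i + 1) := by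
          rw [ENNReal.zpow_add h8C0 h8Ct, zpow_one, mul_comm]
      _ ≤ (8 * C) ^ z j := ENNReal.zpow_le_of_le h8C1.le (by omega)
  have main := sparse_sum_sep hpm hp1 hC1 hCt hθ1 hst a' hat' hsep S hS
  calc vnorm p (sig S a) ≤ vnorm p (fun x => (8 * C) * sig S a' x) := by
        refine vnorm_mono hp0 fun x => ?_
        rw [sig, sig, Finset.mul_sum]
        refine Finset.sum_le_sum fun i _ => ?_
        by_cases hx : x ∈ Dy i
        · simpa [hx] using hge i
        · simp [hx]
    _ ≤ (8 * C) * vnorm p (sig S a') := vnorm_const_mul_le hp0 h8C0 h8Ct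
    _ ≤ (8 * C) * (2 / (1 - θ) * vnorm p (phi S a')) := by gcongr
    _ ≤ (8 * C) * (2 / (1 - θ) * vnorm p (phi S a)) := by
        gcongr
        refine vnorm_mono hp0 fun x => phi_le fun i hi hx => (hle i).trans (le_phi hi hx)
    _ = _ := by ring


/-! ### Stopping cubes -/

/-- Average of `f` over the dyadic cube `i`. -/
def av {n : ℕ} (f : (Fin n → ℝ) → ℝ≥0∞) (i : ℤ × (Fin n → ℤ)) : ℝ≥0∞ :=
  (∫⁻ y in Dy i, f y) / volume (Dy i)

lemma av_mul {n : ℕ} (f : (Fin n → ℝ) → ℝ≥0∞) (i : ℤ × (Fin n → ℤ)) :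
    av f i * volume (Dy i) = ∫⁻ y in Dy i, f y :=
  ENNReal.div_mul_cancel (volume_Dy_ne_zero i) (volume_Dy_ne_top i)

lemma union_bound {n : ℕ} (f : (Fin n → ℝ) → ℝ≥0∞) (lam : ℝ≥0∞)
    (G : Finset (ℤ × (Fin n → ℤ))) (h : ∀ j ∈ G, lam * volume (Dy j) ≤ ∫⁻ y in Dy j, f y) :
    lam * volume (⋃ j ∈ G, Dy j) ≤ ∫⁻ y in ⋃ j ∈ G, Dy j, f y := by
  classical
  induction G using Finset.induction_on_min_value (fun i : ℤ × (Fin n → ℤ) => i.1) with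
  | empty => simp
  | insert m s hm hmin ih =>
    have ih' := ih fun j hj => h j (Finset.mem_insert_of_mem hj)
    rw [Finset.set_biUnion_insert]
    by_cases hex : ∃ i ∈ s, (Dy m ∩ Dy i).Nonempty
    · obtain ⟨i, hi, x, hx1, hx2⟩ := hex
      have hsub : Dy m ⊆ ⋃ j ∈ s, Dy j :=
        (Dy_nested (hmin i hi) hx1 hx2).trans (subset_biUnion_of_mem (u := fun j => Dy j) hi)
      rw [union_eq_right.2 hsub]
      exact ih'
    · have hdis : Disjoint (Dy m) (⋃ j ∈ s, Dy j) := by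
        rw [Set.disjoint_left]
        intro x hx hx'
        simp only [mem_iUnion] at hx'
        obtain ⟨i, hi, hxi⟩ := hx'
        exact hex ⟨i, hi, x, hx, hxi⟩
      rw [lintegral_union (Finset.measurableSet_biUnion _ fun j _ => measurableSet_Dy j) hdis]
      calc _ ≤ lam * (volume (Dy m) + volume (⋃ j ∈ s, Dy j)) := by
            gcongr; exact measure_union_le _ _
        _ = lam * volume (Dy m) + lam * volume (⋃ j ∈ s, Dy j) := mul_add _ _ _
        _ ≤ _ := add_le_add (h m (Finset.mem_insert_self _ _)) ih'

lemma MM_le {n : ℕ} (f : (Fin n → ℝ) → ℝ≥0∞) (x : Fin n → ℝ) :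
    MM f x ≤ 4 ^ n * ⨆ i, (Tri i).toSet.indicator (fun _ => av f i) x := by
  set Z := ⨆ i, (Tri i).toSet.indicator (fun _ => av f i) x with hZ
  refine iSup₂_le fun Q hx => ?_
  obtain ⟨k', hk1, hk2⟩ := exists_mem_Ioc_zpow Q.side_pos (one_lt_two (α := ℝ))
  set k := k' + 1 with hk
  have h2k : (2 : ℝ) ^ k = 2 * 2 ^ k' := by rw [hk, zpow_add₀ (by norm_num), zpow_one, mul_comm]
  have hpos : (0 : ℝ) < 2 ^ k := by positivity
  set m0 : Fin n → ℤ := fun t => ⌊(Q.center t - Q.side / 2) / 2 ^ k⌋ with hm0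
  have hl : ∀ t, (m0 t : ℝ) * 2 ^ k ≤ Q.center t - Q.side / 2 := fun t => by
    have := Int.floor_le ((Q.center t - Q.side / 2) / (2 : ℝ) ^ k)
    rwa [le_div_iff₀ hpos] at this
  have hr : ∀ t, Q.center t - Q.side / 2 < ((m0 t : ℝ) + 1) * 2 ^ k := fun t => by
    have := Int.lt_floor_add_one ((Q.center t - Q.side / 2) / (2 : ℝ) ^ k)
    rwa [div_lt_iff₀ hpos] at this
  set idx : (Fin n → Fin 2) → ℤ × (Fin n → ℤ) :=
    fun e => (k, fun t => m0 t + ((e t : ℕ) : ℤ)) with hidx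
  have hcov : Q.toSet ⊆ ⋃ e, Dy (idx e) := by
    intro y hy
    refine mem_iUnion.2 ⟨fun t => if y t < ((m0 t : ℝ) + 1) * 2 ^ k then 0 else 1, ?_⟩
    intro t _
    have h1 := abs_le.1 (hy t)
    have h3 := hl t
    have h4 := hr t
    simp only [hidx]
    split_ifs with hlt
    · constructor
      · simp; linarith
      · simpa using hlt
    · push Not at hlt
      constructor
      · simpa using hlt
      · simp only [Fin.val_one, Nat.cast_one, Int.cast_add, Int.cast_one]
        linarith
  have hxT : ∀ e, x ∈ (Tri (idx e)).toSet := by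
    intro e t
    have h1 := abs_le.1 (hx t)
    have h3 := hl t
    have h4 := hr t
    simp only [Tri, hidx]
    have he : (e t : ℕ) = 0 ∨ (e t : ℕ) = 1 := by omega
    rw [abs_le]
    rcases he with he | he <;> rw [he] <;> push_cast <;> constructor <;> linarith
  have hav : ∀ e, (∫⁻ y in Dy (idx e), f y) ≤ Z * (2 ^ n * volume Q.toSet) := by
    intro e
    rw [← av_mul]
    have h1 : av f (idx e) ≤ Z := by
      refine le_trans ?_ (le_iSup (fun i => (Tri i).toSet.indicator (fun _ => av f i) x) (idx e))
      simp [hxT e]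
    have h2 : volume (Dy (idx e)) ≤ 2 ^ n * volume Q.toSet := by
      rw [volume_Dy, volume_toSet, ← mul_pow]
      refine pow_le_pow_left₀ zero_le ?_ n
      have : (2 : ℝ≥0∞) = ENNReal.ofReal 2 := by simp
      rw [this, ← ENNReal.ofReal_mul (by norm_num)]
      refine ENNReal.ofReal_le_ofReal ?_
      simp only [hidx]
      linarith
    gcongr
  have hv0 : volume Q.toSet ≠ 0 := by
    rw [volume_toSet]; exact pow_ne_zero _ (by simpa using Q.side_pos)
  have hvt : volume Q.toSet ≠ ∞ := by
    rw [volume_toSet]; exact ENNReal.pow_ne_top ENNReal.ofReal_ne_top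
  rw [ENNReal.div_le_iff_le_mul (Or.inl hv0) (Or.inl hvt)]
  calc (∫⁻ y in Q.toSet, f y) ≤ ∫⁻ y in ⋃ e, Dy (idx e), f y := lintegral_mono_set hcov
    _ ≤ ∑' e, ∫⁻ y in Dy (idx e), f y := lintegral_iUnion_le _ _
    _ = ∑ e, ∫⁻ y in Dy (idx e), f y := tsum_fintype _
    _ ≤ ∑ e : Fin n → Fin 2, Z * (2 ^ n * volume Q.toSet) := Finset.sum_le_sum fun e _ => hav e
    _ = 2 ^ n * (Z * (2 ^ n * volume Q.toSet)) := by simp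
    _ = 4 ^ n * Z * volume Q.toSet := by
        have : (4 : ℝ≥0∞) = 2 * 2 := by norm_num
        rw [this, mul_pow]; ring

lemma sparse_of_levels {n : ℕ} (f : (Fin n → ℝ) → ℝ≥0∞) (T : Finset (ℤ × (Fin n → ℤ)))
    (h0 : ∀ i ∈ T, av f i ≠ 0) (ht : ∀ i ∈ T, av f i ≠ ∞)
    (h2 : ∀ i ∈ T, ∀ j ∈ T, j.1 < i.1 → (Dy j ∩ Dy i).Nonempty → 2 * av f i ≤ av f j) :
    Sparse T := by
  classical
  intro i hi
  set G := T.filter (fun j => j.1 < i.1 ∧ (Dy j ∩ Dy i).Nonempty) with hG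
  set U := ⋃ j ∈ G, Dy j with hU
  have hUsub : U ⊆ Dy i := by
    refine iUnion₂_subset fun j hj => ?_
    obtain ⟨_, hlt, x, hx1, hx2⟩ := Finset.mem_filter.1 hj
    exact Dy_nested hlt.le hx1 hx2
  have hES : Dy i \ U ⊆ ES T i := by
    rintro y ⟨hy1, hy2⟩
    refine ⟨hy1, fun hy3 => hy2 ?_⟩
    simp only [mem_iUnion] at hy3
    obtain ⟨j, hj, hyj⟩ := hy3
    obtain ⟨hjT, hlt⟩ := Finset.mem_filter.1 hj
    exact mem_biUnion (show j ∈ _ from Finset.mem_filter.2 ⟨hjT, hlt, y, hyj, hy1⟩) hyj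
  have h1 : 2 * av f i * volume U ≤ av f i * volume (Dy i) := by
    rw [av_mul]
    refine le_trans (union_bound f _ G ?_) (lintegral_mono_set hUsub)
    intro j hj
    obtain ⟨hjT, hlt, hne⟩ := Finset.mem_filter.1 hj
    rw [← av_mul]
    gcongr
    exact h2 i hi j hjT hlt hne
  have h3 : 2 * volume U ≤ volume (Dy i) := by
    have : av f i * (2 * volume U) ≤ av f i * volume (Dy i) := by
      refine le_trans (le_of_eq ?_) h1; ring
    exact (ENNReal.mul_le_mul_iff_right (h0 i hi) (ht i hi)).1 this
  have h4 : volume (Dy i) ≤ volume (ES T i) + volume U := by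
    calc volume (Dy i) ≤ volume ((Dy i \ U) ∪ U) := measure_mono (by simp)
      _ ≤ volume (Dy i \ U) + volume U := measure_union_le _ _
      _ ≤ _ := by gcongr
  have h5 : volume (Dy i) + volume (Dy i) ≤ 2 * volume (ES T i) + volume (Dy i) := by
    calc volume (Dy i) + volume (Dy i) = 2 * volume (Dy i) := (two_mul _).symm
      _ ≤ 2 * (volume (ES T i) + volume U) := by gcongr
      _ = 2 * volume (ES T i) + 2 * volume U := mul_add _ _ _
      _ ≤ _ := by gcongr
  exact (ENNReal.add_le_add_iff_right (volume_Dy_ne_top i)).1 h5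

lemma stopping {n : ℕ} (f : (Fin n → ℝ) → ℝ≥0∞) (hf : ∀ i, av f i ≠ ∞)
    (F : Finset (ℤ × (Fin n → ℤ))) :
    ∃ S0 S1 : Finset (ℤ × (Fin n → ℤ)), Sparse S0 ∧ Sparse S1 ∧
      ∀ i ∈ F, av f i ≠ 0 → ∃ j, (j ∈ S0 ∨ j ∈ S1) ∧ av f i ≤ 2 * av f j ∧
        (Tri i).toSet ⊆ (Tri j).toSet := by
  classical
  have hex : ∀ i, ∃ z : ℤ, av f i ≠ 0 → av f i ∈ Ico ((2 : ℝ≥0∞) ^ z) (2 ^ (z + 1)) := by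
    intro i
    by_cases h : av f i = 0
    · exact ⟨0, fun h' => absurd h h'⟩
    · obtain ⟨z, hz⟩ := ENNReal.exists_mem_Ico_zpow h (hf i) (y := 2) (by norm_num) (by norm_num)
      exact ⟨z, fun _ => hz⟩
  choose κ hκ using hex
  have hsucc : ∀ z : ℤ, (2 : ℝ≥0∞) ^ (z + 1) = 2 * 2 ^ z := fun z => by
    rw [ENNReal.zpow_add (by norm_num) (by norm_num), zpow_one, mul_comm]
  set F' := F.filter (fun i => av f i ≠ 0) with hF'
  set S := F'.filter (fun i => ∀ j ∈ F', i.1 < j.1 → (Dy i ∩ Dy j).Nonempty → κ j < κ i) with hS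
  have hSF : ∀ i ∈ S, i ∈ F' := fun i hi => (Finset.mem_filter.1 hi).1
  have h0 : ∀ i ∈ F', av f i ≠ 0 := fun i hi => (Finset.mem_filter.1 hi).2
  have hsp : ∀ T ⊆ S, (∀ i ∈ T, ∀ j ∈ T, κ i < κ j → κ i + 2 ≤ κ j) → Sparse T := by
    intro T hTS hT
    refine sparse_of_levels f T (fun i hi => h0 i (hSF i (hTS hi))) (fun i _ => hf i) ?_
    intro i hi j hj hlt hne
    have h1 := (Finset.mem_filter.1 (hTS hj)).2 i (hSF i (hTS hi)) hlt hne
    have h2 := hT i hi j hj h1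
    calc 2 * av f i ≤ 2 * 2 ^ (κ i + 1) := by
          gcongr; exact (hκ i (h0 i (hSF i (hTS hi)))).2.le
      _ = 2 ^ (κ i + 2) := by rw [← hsucc]; congr 1; ring
      _ ≤ 2 ^ κ j := ENNReal.zpow_le_of_le (by norm_num) h2
      _ ≤ av f j := (hκ j (h0 j (hSF j (hTS hj)))).1
  refine ⟨S.filter (fun i => κ i % 2 = 0), S.filter (fun i => ¬ κ i % 2 = 0),
    hsp _ (Finset.filter_subset _ _) ?_, hsp _ (Finset.filter_subset _ _) ?_, ?_⟩
  · intro i hi j hj h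
    have := (Finset.mem_filter.1 hi).2
    have := (Finset.mem_filter.1 hj).2
    omega
  · intro i hi j hj h
    have := (Finset.mem_filter.1 hi).2
    have := (Finset.mem_filter.1 hj).2
    omega
  intro i hi hi0
  have hiF : i ∈ F' := Finset.mem_filter.2 ⟨hi, hi0⟩
  have hxi : (Dy i).Nonempty := by
    rw [Set.nonempty_iff_ne_empty]
    intro h
    exact volume_Dy_ne_zero i (by rw [h]; simp)
  obtain ⟨x, hx⟩ := hxi
  obtain ⟨j, hj, hmax⟩ := Finset.exists_max_image
    (F'.filter fun j => i.1 ≤ j.1 ∧ x ∈ Dy j ∧ κ i ≤ κ j) (fun j => j.1)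
    ⟨i, Finset.mem_filter.2 ⟨hiF, le_rfl, hx, le_rfl⟩⟩
  obtain ⟨hjF, hij, hxj, hκij⟩ := Finset.mem_filter.1 hj
  have hjS : j ∈ S := by
    refine Finset.mem_filter.2 ⟨hjF, fun l hl hlt hne => ?_⟩
    by_contra hcon
    push Not at hcon
    obtain ⟨y, hy1, hy2⟩ := hne
    have hxl : x ∈ Dy l := Dy_nested hlt.le hy1 hy2 hxj
    exact absurd (hmax l (Finset.mem_filter.2 ⟨hl, hij.trans hlt.le, hxl, hκij.trans hcon⟩))
      (not_le.2 hlt)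
  refine ⟨j, ?_, ?_, Tri_nested hij hx hxj⟩
  · by_cases h : κ j % 2 = 0
    · exact Or.inl (Finset.mem_filter.2 ⟨hjS, h⟩)
    · exact Or.inr (Finset.mem_filter.2 ⟨hjS, h⟩)
  · calc av f i ≤ 2 ^ (κ i + 1) := (hκ i hi0).2.le
      _ = 2 * 2 ^ κ i := hsucc _
      _ ≤ 2 * 2 ^ κ j := by gcongr 2 * ?_; exact ENNReal.zpow_le_of_le (by norm_num) hκij
      _ ≤ 2 * av f j := by gcongr; exact (hκ j (h0 j hjF)).1


/-! ### Duality -/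

lemma young_aux {p : ℝ} (hp : 1 < p) (a b : ℝ≥0∞) : a * b ≤ a ^ (p / (p - 1)) + b ^ p := by
  have hc : (p / (p - 1)).HolderConjugate p := (Real.HolderConjugate.conjExponent hp).symm
  refine (ENNReal.young_inequality a b hc).trans ?_
  refine add_le_add (ENNReal.div_le_of_le_mul ?_) (ENNReal.div_le_of_le_mul ?_)
  · exact le_mul_of_one_le_right' (by simpa using hc.lt.le)
  · exact le_mul_of_one_le_right' (by simpa using hp.le)

lemma pairing {n : ℕ} {p : (Fin n → ℝ) → ℝ} (hpm : Measurable p) (hp1 : ∀ x, 1 < p x)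
    {C D : ℝ≥0∞} (hCt : C ≠ ∞) (hDt : D ≠ ∞)
    (hM : ∀ h : (Fin n → ℝ) → ℝ≥0∞, Measurable h → (∀ x, h x ≠ ∞) → vnorm p h < ∞ →
        vnorm p (MM h) ≤ C * vnorm p h)
    (hD : ∀ (S : Finset (ℤ × (Fin n → ℤ))), Sparse S →
      ∀ a : ℤ × (Fin n → ℤ) → ℝ≥0∞, (∀ i, a i ≠ ∞) →
        vnorm p (sig S a) ≤ D * vnorm p (phi S a))
    {f g : (Fin n → ℝ) → ℝ≥0∞} (hf : Measurable f)
    (hfq : ∫⁻ x, f x ^ (p x / (p x - 1)) ≤ 1) (hg : Measurable g) (hgt : ∀ x, g x ≠ ∞)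
    (hgi : ∀ i, ∫⁻ y in (Tri i).toSet, g y ≠ ∞) {m : ℝ≥0∞} (hm0 : m ≠ 0) (hmt : m ≠ ∞)
    (hgm : vnorm p g ≤ m) {S : Finset (ℤ × (Fin n → ℤ))} (hS : Sparse S) :
    ∑ j ∈ S, av f j * ∫⁻ y in (Tri j).toSet, g y ≤ 3 ^ n * (2 * ((D * C + 1) * m)) := by
  have hp0 : ∀ x, 0 ≤ p x := fun x => (zero_lt_one.trans (hp1 x)).le
  set L : ℝ≥0∞ := (D * C + 1) * m with hL
  have hDC : D * C ≠ ∞ := ENNReal.mul_ne_top hDt hCt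
  have hLt : L ≠ ∞ := ENNReal.mul_ne_top (by simp [hDC]) hmt
  have hL0 : L ≠ 0 := mul_ne_zero (by simp) hm0
  have h3t : (3 : ℝ≥0∞) ^ n ≠ ∞ := ENNReal.pow_ne_top (by simp)
  have h30 : (3 : ℝ≥0∞) ^ n ≠ 0 := pow_ne_zero _ (by simp)
  set a : ℤ × (Fin n → ℤ) → ℝ≥0∞ :=
    fun i => (∫⁻ y in (Tri i).toSet, g y) / volume (Tri i).toSet with ha
  have hvT0 : ∀ i : ℤ × (Fin n → ℤ), volume (Tri i).toSet ≠ 0 := fun i => by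
    rw [volume_Tri]; exact mul_ne_zero h30 (volume_Dy_ne_zero i)
  have hvTt : ∀ i : ℤ × (Fin n → ℤ), volume (Tri i).toSet ≠ ∞ := fun i => by
    rw [volume_Tri]; exact ENNReal.mul_ne_top h3t (volume_Dy_ne_top i)
  have hat : ∀ i, a i ≠ ∞ := fun i => ENNReal.div_ne_top (hgi i) (hvT0 i)
  have h1 : vnorm p (sig S a) < L := by
    calc vnorm p (sig S a) ≤ D * vnorm p (phi S a) := hD S hS a hat
      _ ≤ D * vnorm p (MM g) := by
          gcongr
          refine vnorm_mono hp0 fun x => phi_le fun i _ hx => ?_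
          exact le_iSup₂_of_le (Tri i) (Dy_subset_Tri i hx) le_rfl
      _ ≤ D * (C * m) := by
          gcongr
          exact (hM g hg hgt (hgm.trans_lt hmt.lt_top)).trans (by gcongr)
      _ = (D * C) * m := by ring
      _ < L := by
          rw [hL, add_mul, one_mul]
          exact ENNReal.lt_add_right (ENNReal.mul_ne_top hDC hmt) hm0
  have h2 := mod_le_of_vnorm_lt hp0 h1
  have h3 : ∫⁻ x, f x * sig S a x ≤ 2 * L := by
    calc ∫⁻ x, f x * sig S a x
        ≤ ∫⁻ x, L * (f x ^ (p x / (p x - 1)) + (sig S a x / L) ^ p x) := by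
          refine lintegral_mono fun x => ?_
          calc f x * sig S a x = L * (f x * (sig S a x / L)) := by
                rw [mul_left_comm, ENNReal.mul_div_cancel hL0 hLt]
            _ ≤ _ := by gcongr; exact young_aux (hp1 x) _ _
      _ = L * (∫⁻ x, f x ^ (p x / (p x - 1)) + (sig S a x / L) ^ p x) :=
          lintegral_const_mul' _ _ hLt
      _ = L * ((∫⁻ x, f x ^ (p x / (p x - 1))) + ∫⁻ x, (sig S a x / L) ^ p x) := by
          rw [lintegral_add_left]
          exact hf.pow (hpm.div (hpm.sub measurable_const))
      _ ≤ L * (1 + 1) := by gcongr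
      _ = 2 * L := by rw [one_add_one_eq_two, mul_comm]
  have h4 : ∫⁻ x, f x * sig S a x = ∑ i ∈ S, a i * (av f i * volume (Dy i)) := by
    simp only [sig, Finset.mul_sum]
    rw [lintegral_finsetSum]
    swap
    · exact fun i _ => hf.mul (measurable_const.indicator (measurableSet_Dy i))
    refine Finset.sum_congr rfl fun i _ => ?_
    rw [av_mul, ← lintegral_const_mul _ hf, ← lintegral_indicator (measurableSet_Dy i)]
    refine lintegral_congr fun x => ?_
    by_cases hx : x ∈ Dy i
    · simp [hx, mul_comm]
    · simp [hx]
  calc ∑ j ∈ S, av f j * ∫⁻ y in (Tri j).toSet, g y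
      = 3 ^ n * ∑ i ∈ S, a i * (av f i * volume (Dy i)) := by
        rw [Finset.mul_sum]
        refine Finset.sum_congr rfl fun i _ => ?_
        have : a i * volume (Tri i).toSet = ∫⁻ y in (Tri i).toSet, g y :=
          ENNReal.div_mul_cancel (hvT0 i) (hvTt i)
        rw [← this, volume_Tri]; ring
    _ ≤ 3 ^ n * (2 * L) := by rw [← h4]; gcongr


/-- Finite truncation of the tripled dyadic maximal function. -/
def FF {n : ℕ} (f : (Fin n → ℝ) → ℝ≥0∞) (G : Finset (ℤ × (Fin n → ℤ))) (x : Fin n → ℝ) : ℝ≥0∞ :=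
  G.sup fun i => (Tri i).toSet.indicator (fun _ => av f i) x

lemma measurable_FF {n : ℕ} (f : (Fin n → ℝ) → ℝ≥0∞) (G : Finset (ℤ × (Fin n → ℤ))) :
    Measurable (FF f G) := by
  have : FF f G = fun x => ⨆ i ∈ (G : Set (ℤ × (Fin n → ℤ))),
      (Tri i).toSet.indicator (fun _ => av f i) x := by
    ext x; rw [FF, Finset.sup_eq_iSup]; rfl
  rw [this]
  exact Measurable.biSup _ G.countable_toSet fun i _ =>
    measurable_const.indicator (measurableSet_toSet _)

lemma self_le_one_add_rpow (a : ℝ≥0∞) {q : ℝ} (hq : 1 ≤ q) : a ≤ 1 + a ^ q := by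
  rcases le_total a 1 with h | h
  · exact h.trans le_self_add
  · calc a = a ^ (1 : ℝ) := (ENNReal.rpow_one a).symm
      _ ≤ a ^ q := ENNReal.rpow_le_rpow_of_exponent_le h hq
      _ ≤ _ := le_add_self

lemma av_ne_top {n : ℕ} {q : (Fin n → ℝ) → ℝ} (hq : ∀ x, 1 ≤ q x) {f : (Fin n → ℝ) → ℝ≥0∞}
    (hfq : ∫⁻ x, f x ^ q x ≤ 1) (i : ℤ × (Fin n → ℤ)) : av f i ≠ ∞ := by
  refine ENNReal.div_ne_top ?_ (volume_Dy_ne_zero i)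
  have : ∫⁻ y in Dy i, f y ≤ volume (Dy i) + 1 := by
    calc ∫⁻ y in Dy i, f y ≤ ∫⁻ y in Dy i, (1 + f y ^ q y) :=
          lintegral_mono fun y => self_le_one_add_rpow _ (hq y)
      _ = volume (Dy i) + ∫⁻ y in Dy i, f y ^ q y := by
          rw [lintegral_add_left measurable_const]; simp
      _ ≤ _ := by gcongr; exact (setLIntegral_le_lintegral _ _).trans hfq
  exact ne_top_of_le_ne_top (ENNReal.add_ne_top.2 ⟨volume_Dy_ne_top i, by simp⟩) this

lemma bootstrap {L K : ℝ≥0∞} {c : ℝ} (hc : 1 < c) (hL1 : 1 ≤ L) (hLt : L ≠ ∞)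
    (h : L ≤ K * L ^ (1 / c)) : L ≤ K ^ (1 - 1 / c)⁻¹ := by
  have hL0 : L ≠ 0 := (zero_lt_one.trans_le hL1).ne'
  have hc1 : 0 < 1 - 1 / c := by
    rw [sub_pos, div_lt_one (by linarith)]; exact hc
  have h1 : L ^ (1 - 1 / c) ≤ K := by
    rw [ENNReal.rpow_sub _ _ hL0 hLt, ENNReal.rpow_one]
    exact ENNReal.div_le_of_le_mul h
  calc L = (L ^ (1 - 1 / c)) ^ (1 - 1 / c)⁻¹ := by
        rw [← ENNReal.rpow_mul, mul_inv_cancel₀ hc1.ne', ENNReal.rpow_one]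
    _ ≤ _ := ENNReal.rpow_le_rpow h1 (inv_nonneg.2 hc1.le)

lemma finite_est {n : ℕ} {p : (Fin n → ℝ) → ℝ} (hpm : Measurable p) {c : ℝ} (hc : 1 < c)
    (hpc : ∀ x, c ≤ p x)
    {C D : ℝ≥0∞} (hCt : C ≠ ∞) (hDt : D ≠ ∞)
    (hM : ∀ h : (Fin n → ℝ) → ℝ≥0∞, Measurable h → (∀ x, h x ≠ ∞) → vnorm p h < ∞ →
        vnorm p (MM h) ≤ C * vnorm p h)
    (hD : ∀ (S : Finset (ℤ × (Fin n → ℤ))), Sparse S →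
      ∀ a : ℤ × (Fin n → ℤ) → ℝ≥0∞, (∀ i, a i ≠ ∞) →
        vnorm p (sig S a) ≤ D * vnorm p (phi S a))
    {f : (Fin n → ℝ) → ℝ≥0∞} (hf : Measurable f)
    (hfq : ∫⁻ x, f x ^ (p x / (p x - 1)) ≤ 1) (G : Finset (ℤ × (Fin n → ℤ))) :
    ∫⁻ x, FF f G x ^ (p x / (p x - 1)) ≤ (8 * 3 ^ n * (D * C + 1)) ^ (1 - 1 / c)⁻¹ := by
  classical
  have hp1 : ∀ x, 1 < p x := fun x => hc.trans_le (hpc x)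
  set q : (Fin n → ℝ) → ℝ := fun x => p x / (p x - 1) with hq
  have hqm : Measurable q := hpm.div (hpm.sub measurable_const)
  have hq1 : ∀ x, q x - 1 = 1 / (p x - 1) := fun x => by
    have := hp1 x
    have : p x - 1 ≠ 0 := by linarith
    simp only [hq]; field_simp; ring
  have hq1' : ∀ x, 0 ≤ q x - 1 := fun x => by
    rw [hq1]; have := hp1 x; exact div_nonneg zero_le_one (by linarith)
  have hqQ : ∀ x, q x ≤ c / (c - 1) := fun x => by
    have h1 := hq1 x
    have h2 : 1 / (p x - 1) ≤ 1 / (c - 1) :=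
      one_div_le_one_div_of_le (by linarith) (by linarith [hpc x])
    have h3 : c / (c - 1) = 1 + 1 / (c - 1) := by
      have : c - 1 ≠ 0 := by linarith
      field_simp; ring
    linarith
  set Q : ℝ := c / (c - 1) with hQ
  have hQ0 : 0 ≤ Q := div_nonneg (by linarith) (by linarith)
  have hav : ∀ i, av f i ≠ ∞ := av_ne_top (q := q) (fun x => by linarith [hq1' x]) hfq
  set F := FF f G with hF
  have hFm : Measurable F := measurable_FF f G
  set m : ℝ≥0∞ := max 1 (G.sup (av f)) with hm
  have hmt : m ≠ ∞ := by
    rw [hm]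
    refine (max_lt (by simp) ?_).ne
    exact (Finset.sup_lt_iff (by simp)).2 fun i _ => (hav i).lt_top
  have hm1 : 1 ≤ m := le_max_left _ _
  have hFle : ∀ x, F x ≤ m := fun x => by
    refine Finset.sup_le fun i hi => ?_
    refine le_trans ?_ ((Finset.le_sup (f := av f) hi).trans (le_max_right _ _))
    exact indicator_le_self' (fun _ _ => zero_le) x
  have hpowle : ∀ x (r : ℝ), 0 ≤ r → r ≤ Q → F x ^ r ≤ m ^ Q := fun x r h0 hr =>
    (ENNReal.rpow_le_rpow (hFle x) h0).trans (ENNReal.rpow_le_rpow_of_exponent_le hm1 hr)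
  have hmQ : m ^ Q ≠ ∞ := ENNReal.rpow_ne_top_of_nonneg hQ0 hmt
  set U : Set (Fin n → ℝ) := ⋃ i ∈ G, (Tri i).toSet with hU
  have hTt : ∀ i : ℤ × (Fin n → ℤ), volume (Tri i).toSet ≠ ∞ := fun i => by
    rw [volume_Tri]; exact ENNReal.mul_ne_top (ENNReal.pow_ne_top (by simp)) (volume_Dy_ne_top i)
  have hUt : volume U ≠ ∞ := by
    refine ne_top_of_le_ne_top ?_ (measure_biUnion_finset_le G _)
    exact ENNReal.sum_ne_top.2 fun i _ => hTt i
  have hUm : MeasurableSet U := Finset.measurableSet_biUnion _ fun i _ => measurableSet_toSet _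
  have hF0 : ∀ x, x ∉ U → F x = 0 := fun x hx => by
    rw [hF, FF, ← bot_eq_zero, Finset.sup_eq_bot_iff]
    intro i hi
    refine indicator_of_notMem (fun hxi => hx ?_) _
    exact mem_biUnion hi hxi
  set I : ℝ≥0∞ := ∫⁻ x, F x ^ q x with hI
  have hIt : I ≠ ∞ := by
    refine ne_top_of_le_ne_top (ENNReal.mul_ne_top hmQ hUt) ?_
    calc I ≤ ∫⁻ x, U.indicator (fun _ => m ^ Q) x := by
          refine lintegral_mono fun x => ?_
          by_cases hx : x ∈ U
          · simpa [hx] using hpowle x (q x) (by linarith [hq1' x]) (hqQ x)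
          · have : 0 < q x := by linarith [hq1' x]
            simp [hx, hF0 x hx, this]
      _ = _ := by rw [lintegral_indicator hUm]; simp
  set g : (Fin n → ℝ) → ℝ≥0∞ := fun x => F x ^ (q x - 1) with hg
  have hgm : Measurable g := hFm.pow (hqm.sub measurable_const)
  have hgle : ∀ x, g x ≤ m ^ Q := fun x => hpowle x _ (hq1' x) (by linarith [hqQ x])
  have hgt : ∀ x, g x ≠ ∞ := fun x => ne_top_of_le_ne_top hmQ (hgle x)
  have hgi : ∀ i, ∫⁻ y in (Tri i).toSet, g y ≠ ∞ := fun i => by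
    refine ne_top_of_le_ne_top (ENNReal.mul_ne_top hmQ (hTt i)) ?_
    calc ∫⁻ y in (Tri i).toSet, g y ≤ ∫⁻ y in (Tri i).toSet, m ^ Q := lintegral_mono fun y => hgle y
      _ = _ := by simp
  have hgp : ∀ x, g x ^ p x = F x ^ q x := fun x => by
    rw [hg, ← ENNReal.rpow_mul]
    congr 1
    rw [hq1]; simp only [hq]; ring
  have hFg : ∀ x, F x ^ q x = F x * g x := fun x => by
    rw [hg]
    conv_rhs => rw [← ENNReal.rpow_one (F x)]
    simp only [ENNReal.rpow_one]
    conv_lhs => rw [show q x = 1 + (q x - 1) by ring]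
    rw [ENNReal.rpow_add_of_nonneg _ _ zero_le_one (hq1' x), ENNReal.rpow_one]
  set L : ℝ≥0∞ := max 1 I with hL
  have hLt : L ≠ ∞ := (max_lt (by simp) hIt.lt_top).ne
  have hL1 : 1 ≤ L := le_max_left _ _
  have hL0 : L ≠ 0 := (zero_lt_one.trans_le hL1).ne'
  have hc0 : 0 < c := by linarith
  set μ : ℝ≥0∞ := L ^ (1 / c) with hμ
  have hμt : μ ≠ ∞ := ENNReal.rpow_ne_top_of_nonneg (by positivity) hLt
  have hμ1 : 1 ≤ μ := ENNReal.one_le_rpow hL1 (by positivity)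
  have hμ0 : μ ≠ 0 := (zero_lt_one.trans_le hμ1).ne'
  have hgμ : vnorm p g ≤ μ := by
    refine vnorm_le_of_mod (pos_iff_ne_zero.2 hμ0) ?_
    calc ∫⁻ x, (g x / μ) ^ p x ≤ ∫⁻ x, L⁻¹ * F x ^ q x := by
          refine lintegral_mono fun x => ?_
          have hpx : 0 ≤ p x := by linarith [hp1 x]
          change (g x / μ) ^ p x ≤ L⁻¹ * F x ^ q x
          rw [ENNReal.div_rpow_of_nonneg _ _ hpx, hgp, div_eq_mul_inv, mul_comm]
          gcongr
          calc L = μ ^ c := by rw [hμ, ← ENNReal.rpow_mul, one_div_mul_cancel hc0.ne', ENNReal.rpow_one]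
            _ ≤ μ ^ p x := ENNReal.rpow_le_rpow_of_exponent_le hμ1 (hpc x)
      _ = L⁻¹ * I := lintegral_const_mul' _ _ (ENNReal.inv_ne_top.2 hL0)
      _ ≤ L⁻¹ * L := by gcongr; exact le_max_right _ _
      _ = 1 := ENNReal.inv_mul_cancel hL0 hLt
  obtain ⟨S0, S1, hS0, hS1, hst⟩ := stopping f hav G
  have hsum : ∀ S : Finset (ℤ × (Fin n → ℤ)),
      ∫⁻ x, (∑ j ∈ S, (Tri j).toSet.indicator (fun _ => 2 * av f j) x) * g x
        = 2 * ∑ j ∈ S, av f j * ∫⁻ y in (Tri j).toSet, g y := fun S => by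
    simp only [Finset.sum_mul]
    rw [lintegral_finsetSum]
    swap
    · exact fun i _ => (measurable_const.indicator (measurableSet_toSet _)).mul hgm
    rw [Finset.mul_sum]
    refine Finset.sum_congr rfl fun i _ => ?_
    rw [← mul_assoc, ← lintegral_const_mul _ hgm, ← lintegral_indicator (measurableSet_toSet _)]
    refine lintegral_congr fun x => ?_
    by_cases hx : x ∈ (Tri i).toSet
    · simp [hx]
    · simp [hx]
  have hpt : ∀ x, F x ≤ (∑ j ∈ S0, (Tri j).toSet.indicator (fun _ => 2 * av f j) x) +
      ∑ j ∈ S1, (Tri j).toSet.indicator (fun _ => 2 * av f j) x := fun x => by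
    refine Finset.sup_le fun i hi => ?_
    by_cases hx : x ∈ (Tri i).toSet
    swap
    · simp [hx]
    by_cases h0 : av f i = 0
    · simp [h0]
    obtain ⟨j, hj, hle, hsub⟩ := hst i hi h0
    have e1 : (Tri i).toSet.indicator (fun _ => av f i) x ≤
        (Tri j).toSet.indicator (fun _ => 2 * av f j) x := by
      simpa [hx, hsub hx] using hle
    refine e1.trans ?_
    rcases hj with hj | hj
    · exact (Finset.single_le_sum
        (f := fun j => (Tri j).toSet.indicator (fun _ => 2 * av f j) x)
        (fun _ _ => zero_le) hj).trans le_self_add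
    · exact (Finset.single_le_sum
        (f := fun j => (Tri j).toSet.indicator (fun _ => 2 * av f j) x)
        (fun _ _ => zero_le) hj).trans le_add_self
  have hpair : ∀ S : Finset (ℤ × (Fin n → ℤ)), Sparse S →
      ∑ j ∈ S, av f j * ∫⁻ y in (Tri j).toSet, g y ≤ 3 ^ n * (2 * ((D * C + 1) * μ)) :=
    fun S hS => pairing hpm hp1 hCt hDt hM hD hf hfq hgm hgt hgi hμ0 hμt hgμ hS
  have hImain : I ≤ 8 * 3 ^ n * (D * C + 1) * μ := by
    calc I ≤ ∫⁻ x, ((∑ j ∈ S0, (Tri j).toSet.indicator (fun _ => 2 * av f j) x) * g x +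
            (∑ j ∈ S1, (Tri j).toSet.indicator (fun _ => 2 * av f j) x) * g x) := by
          refine lintegral_mono fun x => ?_
          rw [← add_mul]
          change F x ^ q x ≤ _
          rw [hFg]
          gcongr
          exact hpt x
      _ = 2 * (∑ j ∈ S0, av f j * ∫⁻ y in (Tri j).toSet, g y) +
          2 * (∑ j ∈ S1, av f j * ∫⁻ y in (Tri j).toSet, g y) := by
          rw [lintegral_add_left, hsum, hsum]
          exact (Finset.measurable_fun_sum S0 fun i _ =>
            measurable_const.indicator (measurableSet_toSet _)).mul hgm
      _ ≤ 2 * (3 ^ n * (2 * ((D * C + 1) * μ))) + 2 * (3 ^ n * (2 * ((D * C + 1) * μ))) := by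
          gcongr
          · exact hpair S0 hS0
          · exact hpair S1 hS1
      _ = _ := by ring
  have hK1 : 1 ≤ 8 * 3 ^ n * (D * C + 1) := by
    refine one_le_mul (one_le_mul (by norm_num) (one_le_pow₀ (by norm_num))) le_add_self
  have hLmain : L ≤ 8 * 3 ^ n * (D * C + 1) * L ^ (1 / c) :=
    max_le (one_le_mul hK1 hμ1) hImain
  exact (le_max_right _ _).trans (bootstrap hc hL1 hLt hLmain)


lemma full_mod {n : ℕ} {q : (Fin n → ℝ) → ℝ} (hqm : Measurable q) (hq1 : ∀ x, 1 ≤ q x)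
    {f : (Fin n → ℝ) → ℝ≥0∞} {K : ℝ≥0∞} (hK1 : 1 ≤ K) (hKt : K ≠ ∞)
    (h : ∀ G, ∫⁻ x, FF f G x ^ q x ≤ K) :
    ∫⁻ x, (MM f x / (4 ^ n * K)) ^ q x ≤ 1 := by
  classical
  have hK0 : K ≠ 0 := (zero_lt_one.trans_le hK1).ne'
  have hq0 : ∀ x, 0 < q x := fun x => zero_lt_one.trans_le (hq1 x)
  have h40 : (4 : ℝ≥0∞) ^ n ≠ 0 := pow_ne_zero _ (by norm_num)
  have h4t : (4 : ℝ≥0∞) ^ n ≠ ∞ := ENNReal.pow_ne_top (by norm_num)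
  have hmono : ∀ x, Monotone fun G => FF f G x := fun x G G' hG => Finset.sup_mono hG
  have hZ : ∀ x, MM f x / 4 ^ n ≤ ⨆ G, FF f G x := fun x => by
    refine ENNReal.div_le_of_le_mul' ((MM_le f x).trans ?_)
    gcongr
    refine iSup_le fun i => ?_
    refine le_iSup_of_le {i} ?_
    simp [FF]
  have hpt : ∀ x, (MM f x / (4 ^ n * K)) ^ q x ≤ K⁻¹ * ⨆ G, FF f G x ^ q x := fun x => by
    calc (MM f x / (4 ^ n * K)) ^ q x = (MM f x / 4 ^ n / K) ^ q x := by
          congr 1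
          rw [div_eq_mul_inv, div_eq_mul_inv, div_eq_mul_inv, mul_assoc,
            ENNReal.mul_inv (Or.inl h40) (Or.inl h4t)]
      _ ≤ ((⨆ G, FF f G x) / K) ^ q x := by
          refine ENNReal.rpow_le_rpow (ENNReal.div_le_div_right (hZ x) _) (hq0 x).le
      _ = (K ^ q x)⁻¹ * (⨆ G, FF f G x) ^ q x := by
          rw [ENNReal.div_rpow_of_nonneg _ _ (hq0 x).le, div_eq_mul_inv, mul_comm]
      _ ≤ K⁻¹ * (⨆ G, FF f G x) ^ q x := by
          gcongr
          calc K = K ^ (1 : ℝ) := (ENNReal.rpow_one K).symm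
            _ ≤ _ := ENNReal.rpow_le_rpow_of_exponent_le hK1 (hq1 x)
      _ = K⁻¹ * ⨆ G, FF f G x ^ q x := by
          congr 1
          exact (ENNReal.orderIsoRpow (q x) (hq0 x)).map_iSup _
  calc ∫⁻ x, (MM f x / (4 ^ n * K)) ^ q x ≤ ∫⁻ x, K⁻¹ * ⨆ G, FF f G x ^ q x := lintegral_mono hpt
    _ = K⁻¹ * ∫⁻ x, ⨆ G, FF f G x ^ q x := lintegral_const_mul' _ _ (ENNReal.inv_ne_top.2 hK0)
    _ = K⁻¹ * ⨆ G, ∫⁻ x, FF f G x ^ q x := by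
        congr 1
        refine lintegral_iSup_directed (fun G => ((measurable_FF f G).pow hqm).aemeasurable) ?_
        refine Monotone.directed_le fun G G' hG x => ?_
        exact ENNReal.rpow_le_rpow (hmono x hG) (hq0 x).le
    _ ≤ K⁻¹ * K := by gcongr; exact iSup_le h
    _ = 1 := ENNReal.inv_mul_cancel hK0 hKt

lemma MM_scale {n : ℕ} {h : (Fin n → ℝ) → ℝ≥0∞} {m : ℝ≥0∞} (hm0 : m ≠ 0) (hmt : m ≠ ∞)
    (x : Fin n → ℝ) : MM h x / m ≤ MM (fun y => h y / m) x := by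
  refine ENNReal.div_le_of_le_mul' (iSup₂_le fun Q hx => ?_)
  calc (∫⁻ y in Q.toSet, h y) / volume Q.toSet
      = m * ((∫⁻ y in Q.toSet, h y / m) / volume Q.toSet) := by
        rw [← mul_div_assoc, ← lintegral_const_mul' _ _ hmt]
        congr 1
        refine lintegral_congr fun y => ?_
        rw [ENNReal.mul_div_cancel hm0 hmt]
    _ ≤ _ := by
        gcongr
        exact le_iSup₂_of_le (f := fun (Q : RCube n) (_ : x ∈ Q.toSet) =>
          (∫⁻ y in Q.toSet, h y / m) / volume Q.toSet) Q hx le_rfl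

theorem core {n : ℕ} {p : (Fin n → ℝ) → ℝ} (hpm : Measurable p) {c B : ℝ} (hc : 1 < c)
    (hpc : ∀ x, c ≤ p x) (hpB : ∀ x, p x ≤ B) (hMB : MaximalBounded p) :
    MaximalBounded fun x => p x / (p x - 1) := by
  obtain ⟨C0, hC0, hC⟩ := hMB
  have hp1 : ∀ x, 1 ≤ p x := fun x => hc.le.trans (hpc x)
  set C : ℝ≥0∞ := max 1 (ENNReal.ofReal C0) with hCdef
  have hC1 : 1 ≤ C := le_max_left _ _
  have hCt : C ≠ ∞ := (max_lt (by simp) ENNReal.ofReal_lt_top).ne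
  have hM : ∀ h : (Fin n → ℝ) → ℝ≥0∞, Measurable h → (∀ x, h x ≠ ∞) → vnorm p h < ∞ →
      vnorm p (MM h) ≤ C * vnorm p h := by
    intro h hm ht hv
    have e : ofR (fun x => (h x).toReal) = h := by
      ext x
      simp only [ofR]
      rw [abs_of_nonneg ENNReal.toReal_nonneg, ENNReal.ofReal_toReal (ht x)]
    have h1 := hC (fun x => (h x).toReal) hm.ennreal_toReal (by rw [e]; exact hv)
    have e2 : hlMaximal (fun x => (h x).toReal) = MM h := by
      change MM (ofR (fun x => (h x).toReal)) = _
      rw [e]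
    rw [e, e2] at h1
    exact h1.trans (by gcongr; exact le_max_right _ _)
  obtain ⟨D, hDt, hD⟩ := sparse_sum hpm hp1 hpB hC1 hCt hM
  set K : ℝ≥0∞ := (8 * 3 ^ n * (D * C + 1)) ^ (1 - 1 / c)⁻¹ with hK
  have hc1 : 0 < (1 - 1 / c)⁻¹ := by
    rw [inv_pos, sub_pos, div_lt_one (by linarith)]; exact hc
  have hK1 : 1 ≤ K := by
    refine ENNReal.one_le_rpow ?_ hc1
    exact one_le_mul (one_le_mul (by norm_num) (one_le_pow₀ (by norm_num))) le_add_self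
  have hKt : K ≠ ∞ := by
    refine ENNReal.rpow_ne_top_of_nonneg hc1.le ?_
    refine ENNReal.mul_ne_top (ENNReal.mul_ne_top (by norm_num) (ENNReal.pow_ne_top (by norm_num))) ?_
    exact ENNReal.add_ne_top.2 ⟨ENNReal.mul_ne_top hDt hCt, by simp⟩
  set q : (Fin n → ℝ) → ℝ := fun x => p x / (p x - 1) with hq
  have hqm : Measurable q := hpm.div (hpm.sub measurable_const)
  have hq1 : ∀ x, 1 ≤ q x := fun x => by
    have := hpc x
    simp only [hq]
    rw [one_le_div (by linarith)]; linarith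
  have hq0 : ∀ x, 0 ≤ q x := fun x => zero_le_one.trans (hq1 x)
  have hAt : 4 ^ n * K ≠ ∞ := ENNReal.mul_ne_top (ENNReal.pow_ne_top (by norm_num)) hKt
  have hA1 : 1 ≤ 4 ^ n * K := one_le_mul (one_le_pow₀ (by norm_num)) hK1
  have hA0 : 4 ^ n * K ≠ 0 := (zero_lt_one.trans_le hA1).ne'
  refine ⟨(4 ^ n * K).toReal, ENNReal.toReal_pos hA0 hAt, fun f hf hfv => ?_⟩
  rw [ENNReal.ofReal_toReal hAt]
  have hfm : Measurable (ofR f) := by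
    unfold ofR
    exact ENNReal.measurable_ofReal.comp (by simpa using hf.norm)
  change vnorm q (MM (ofR f)) ≤ _
  have key : ∀ m, vnorm q (ofR f) < m → m ≠ ∞ → vnorm q (MM (ofR f)) ≤ (4 ^ n * K) * m := by
    intro m hm hmt
    have hm0 : m ≠ 0 := (pos_of_gt hm).ne'
    have h1 := mod_le_of_vnorm_lt hq0 hm
    have h2 := full_mod hqm hq1 hK1 hKt fun G =>
      finite_est hpm hc hpc hCt hDt hM hD (hfm.div measurable_const) h1 G
    refine vnorm_le_of_mod (pos_iff_ne_zero.2 (mul_ne_zero hA0 hm0)) (le_trans ?_ h2)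
    refine lintegral_mono fun x => ENNReal.rpow_le_rpow ?_ (hq0 x)
    calc MM (ofR f) x / (4 ^ n * K * m) = MM (ofR f) x / m / (4 ^ n * K) := by
          rw [div_eq_mul_inv, div_eq_mul_inv, div_eq_mul_inv,
            ENNReal.mul_inv (Or.inl hA0) (Or.inl hAt), mul_comm _ m⁻¹, mul_assoc]
      _ ≤ _ := ENNReal.div_le_div_right (MM_scale hm0 hmt x) _
  have h3 : vnorm q (MM (ofR f)) / (4 ^ n * K) ≤ vnorm q (ofR f) := by
    refine le_of_forall_gt fun m hm => ?_
    obtain ⟨m', h1, h2⟩ := exists_between hm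
    refine lt_of_le_of_lt ?_ h2
    exact ENNReal.div_le_of_le_mul' (key m' h1 h2.ne_top)
  exact (ENNReal.div_le_iff_le_mul (Or.inl hA0) (Or.inl hAt)).1 h3 |>.trans_eq (mul_comm _ _)

lemma MaximalBounded.congr_ae {n : ℕ} {p p' : (Fin n → ℝ) → ℝ}
    (h : ∀ᵐ x ∂(volume : Measure (Fin n → ℝ)), p x = p' x) (hM : MaximalBounded p) :
    MaximalBounded p' := by
  have e : ∀ f, vnorm p f = vnorm p' f := fun f => by
    unfold vnorm
    congr 1
    ext l
    have : ∫⁻ x, (f x / l) ^ p x = ∫⁻ x, (f x / l) ^ p' x :=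
      lintegral_congr_ae (h.mono fun x hx => by simp only [hx])
    simp only [mem_ofPred_eq, this]
  obtain ⟨C, hC, H⟩ := hM
  refine ⟨C, hC, fun f hf hv => ?_⟩
  rw [← e] at hv
  rw [← e, ← e]
  exact H f hf hv


theorem statement13 {n : ℕ} (p : (Fin n → ℝ) → ℝ) (hpm : Measurable p)
    (hp1 : ∀ x, 1 ≤ p x)
    (hlow : ∃ c : ℝ, 1 < c ∧ ∀ᵐ x ∂(volume : Measure (Fin n → ℝ)), c ≤ p x)
    (hup : ∃ B : ℝ, ∀ᵐ x ∂(volume : Measure (Fin n → ℝ)), p x ≤ B) :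
    MaximalBounded p ↔ MaximalBounded fun x => p x / (p x - 1) := by
  obtain ⟨c, hc, hcp⟩ := hlow
  obtain ⟨B, hB⟩ := hup
  set P : (Fin n → ℝ) → ℝ := fun x => max c (min (p x) (max B c)) with hP
  have hPm : Measurable P := measurable_const.max (hpm.min measurable_const)
  have hPc : ∀ x, c ≤ P x := fun x => le_max_left _ _
  have hPB : ∀ x, P x ≤ max B c := fun x => max_le (le_max_right _ _) (min_le_right _ _)
  have hae : ∀ᵐ x ∂(volume : Measure (Fin n → ℝ)), p x = P x := by
    filter_upwards [hcp, hB] with x h1 h2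
    simp only [hP]
    rw [min_eq_left (h2.trans (le_max_left _ _)), max_eq_right h1]
  have hae' : ∀ᵐ x ∂(volume : Measure (Fin n → ℝ)), p x / (p x - 1) = P x / (P x - 1) :=
    hae.mono fun x hx => by rw [hx]
  constructor
  · intro h
    exact (core hPm hc hPc hPB (h.congr_ae hae)).congr_ae (hae'.mono fun x hx => hx.symm)
  · intro h
    have h1 := h.congr_ae hae'
    set b : ℝ := max B c with hb
    have hbc : c ≤ b := le_max_right _ _
    have hb1 : 1 < b / (b - 1) := by rw [one_lt_div (by linarith)]; linarith
    have hQm : Measurable fun x => P x / (P x - 1) := hPm.div (hPm.sub measurable_const)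
    have hlo : ∀ x, b / (b - 1) ≤ P x / (P x - 1) := fun x => by
      have := hPc x
      have := hPB x
      rw [div_le_div_iff₀ (by linarith) (by linarith)]
      nlinarith
    have hhi : ∀ x, P x / (P x - 1) ≤ c / (c - 1) := fun x => by
      have := hPc x
      rw [div_le_div_iff₀ (by linarith) (by linarith)]
      nlinarith
    refine (core hQm hb1 hlo hhi h1).congr_ae ?_
    filter_upwards [hae] with x hx
    rw [hx]
    have h2 : P x - 1 ≠ 0 := by have := hPc x; linarith
    have h3 : P x / (P x - 1) - 1 = 1 / (P x - 1) := by field_simp; ring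
    rw [h3]
    field_simp
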